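/- Let n ≥ 1, κ ∈ ℕⁿ and let T : ℝ_κ[z₁,…,zₙ] → ℝ[z₁,…,zₙ] be a linear operator. Then T preserves real stability (i.e., for every real stable f ∈ ℝ_κ[z₁,…,zₙ] the polynomial T(f) is real stable or identically zero) if and only if either (a) T has range of dimension at most two and is of the form T(f) = α(f)·P + β(f)·Q, where α, β : ℝ_κ[z₁,…,zₙ] → ℝ are linear functionals and P, Q are real stable polynomials with P ≪ Q, or (b) G_T(z,w) = T[(z+w)^κ] is real stable in 2n variables, or (c) G_T(z,−w) = T[(z−w)^κ] is real stable in 2n variables. -/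

import Mathlib

open MvPolynomial

/-- A complex polynomial is *stable* if it is non-vanishing whenever all
variables lie in the open upper half-plane. -/
def IsStable {σ : Type*} (f : MvPolynomial σ ℂ) : Prop :=
  ∀ z : σ → ℂ, (∀ i, 0 < (z i).im) → MvPolynomial.eval z f ≠ 0

/-- A real polynomial is *real stable* if it is non-vanishing whenever all
variables lie in the open upper half-plane. -/
def IsRealStable {σ : Type*} (f : MvPolynomial σ ℝ) : Prop :=
  ∀ z : σ → ℂ, (∀ i, 0 < (z i).im) → MvPolynomial.aeval z f ≠ 0

/-- `ProperPosition f g` means `f ≪ g`, i.e. `g + i·f` is stable. -/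
def ProperPosition {σ : Type*} (f g : MvPolynomial σ ℝ) : Prop :=
  IsStable (MvPolynomial.map (algebraMap ℝ ℂ) g +
    Complex.I • MvPolynomial.map (algebraMap ℝ ℂ) f)

/-- The signed algebraic symbol
`T[(z + ε·w)^κ] = ∑_{α ≤ κ} ε^{|κ-α|} C(κ,α) T(z^α) w^{κ-α}` of a real linear
operator `T`; for `ε = 1` this is `G_T(z,w)` and for `ε = -1` it is `G_T(z,-w)`. -/
noncomputable def algSymbolSigned {n : ℕ} (ε : ℝ) (κ : Fin n →₀ ℕ)
    (T : MvPolynomial (Fin n) ℝ →ₗ[ℝ] MvPolynomial (Fin n) ℝ) :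
    MvPolynomial (Fin n ⊕ Fin n) ℝ :=
  ∑ α ∈ Finset.Iic κ,
    C (ε ^ ((κ - α).sum fun _ k => k) * ((∏ i, (κ i).choose (α i) : ℕ) : ℝ)) *
      (rename Sum.inl (T (monomial α 1)) *
        monomial (Finsupp.mapDomain Sum.inr (κ - α)) 1)

lemma Multiset.norm_prod_map_complex {α : Type*} (m : Multiset α) (f : α → ℂ) :
    ‖(m.map f).prod‖ = (m.map fun a => ‖f a‖).prod := by
  have := map_multiset_prod (normHom : ℂ →*₀ ℝ) (m.map f)
  simpa [Multiset.map_map, Function.comp_def, normHom] using this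

lemma Polynomial.norm_eval_le_two_pow_mul {p : Polynomial ℂ} {N : ℕ} (hN : p.natDegree ≤ N)
    (hp : ∀ t : ℂ, ‖t‖ < 1 → p.eval t ≠ 0) {t : ℂ} (ht : ‖t‖ ≤ 1) :
    ‖p.eval t‖ ≤ 2 ^ N * ‖p.eval 0‖ := by
  have hs := IsAlgClosed.splits p
  have h0 : p ≠ 0 := by
    rintro rfl
    exact hp 0 (by simp) (by simp)
  have hroot : ∀ a ∈ p.roots, 1 ≤ ‖a‖ := by
    intro a ha
    by_contra! h
    exact hp a h ((Polynomial.mem_roots h0).1 ha)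
  rw [hs.eval_eq_prod_roots t, hs.eval_eq_prod_roots 0, norm_mul, norm_mul,
    Multiset.norm_prod_map_complex, Multiset.norm_prod_map_complex]
  have key : (p.roots.map fun a => ‖t - a‖).prod ≤
      2 ^ N * (p.roots.map fun a => ‖(0 : ℂ) - a‖).prod := by
    calc (p.roots.map fun a => ‖t - a‖).prod
        ≤ (p.roots.map fun a => 2 * ‖(0 : ℂ) - a‖).prod := by
          refine Multiset.prod_map_le_prod_map₀ _ _ (fun a _ => norm_nonneg _) fun a ha => ?_
          have := norm_sub_le t a
          have := hroot a ha
          rw [zero_sub, norm_neg]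
          linarith
      _ = 2 ^ p.roots.card * (p.roots.map fun a => ‖(0 : ℂ) - a‖).prod := by
          rw [Multiset.prod_map_mul, Multiset.map_const', Multiset.prod_replicate]
      _ ≤ _ := by
          gcongr
          · refine Multiset.prod_nonneg fun x hx => ?_
            obtain ⟨a, -, rfl⟩ := Multiset.mem_map.1 hx
            exact norm_nonneg _
          · norm_num
          · exact p.card_roots'.trans hN
  calc _ ≤ ‖p.leadingCoeff‖ * (2 ^ N * (p.roots.map fun a => ‖(0 : ℂ) - a‖).prod) := by gcongr
    _ = _ := by ring

lemma Polynomial.norm_eval_neg_I_le {p : Polynomial ℂ}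
    (hp : ∀ t : ℂ, 0 < t.im → p.eval t ≠ 0) :
    ‖p.eval (-Complex.I)‖ ≤ ‖p.eval Complex.I‖ := by
  have hs := IsAlgClosed.splits p
  have h0 : p ≠ 0 := by
    rintro rfl
    exact hp Complex.I (by simp) (by simp)
  have hroot : ∀ a ∈ p.roots, a.im ≤ 0 := by
    intro a ha
    by_contra! h
    exact hp a h ((Polynomial.mem_roots h0).1 ha)
  rw [hs.eval_eq_prod_roots, hs.eval_eq_prod_roots Complex.I, norm_mul, norm_mul,
    Multiset.norm_prod_map_complex, Multiset.norm_prod_map_complex]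
  refine mul_le_mul_of_nonneg_left ?_ (norm_nonneg _)
  refine Multiset.prod_map_le_prod_map₀ _ _ (fun a _ => norm_nonneg _) fun a ha => ?_
  have := hroot a ha
  rw [← sq_le_sq₀ (norm_nonneg _) (norm_nonneg _), ← Complex.normSq_eq_norm_sq,
    ← Complex.normSq_eq_norm_sq, Complex.normSq_apply, Complex.normSq_apply]
  simp
  nlinarith

/-- The restriction of a polynomial to the complex line through `x` in the direction `y`. -/
noncomputable def MvPolynomial.onLine {σ : Type*} (x y : σ → ℂ) (f : MvPolynomial σ ℂ) :
    Polynomial ℂ :=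
  aeval (fun j => Polynomial.C (x j) + Polynomial.C (y j) * Polynomial.X) f

lemma MvPolynomial.eval_onLine {σ : Type*} (x y : σ → ℂ) (f : MvPolynomial σ ℂ) (t : ℂ) :
    (f.onLine x y).eval t = eval (fun j => x j + y j * t) f := by
  rw [onLine, ← Polynomial.coe_evalRingHom, MvPolynomial.aeval_def, MvPolynomial.hom_eval₂,
    ← MvPolynomial.coe_eval₂Hom]
  simp only [MvPolynomial.eval, Polynomial.coe_evalRingHom, Polynomial.eval_add,
    Polynomial.eval_mul, Polynomial.eval_C, Polynomial.eval_X]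
  congr 2
  ext; simp

lemma MvPolynomial.natDegree_onLine_le {σ : Type*} (x y : σ → ℂ) (f : MvPolynomial σ ℂ) :
    (f.onLine x y).natDegree ≤ f.totalDegree := by
  have := aeval_natDegree_le (n := 1) f le_rfl
    (fun j => Polynomial.C (x j) + Polynomial.C (y j) * Polynomial.X)
    (fun j => by compute_degree)
  simpa [onLine] using this

/-- A form of Hurwitz' theorem for stable polynomials. -/
lemma isStable_or_eq_zero_of_tendsto {σ ι : Type*} [Finite σ] {l : Filter ι} [l.NeBot]
    {f : ι → MvPolynomial σ ℂ} {F : MvPolynomial σ ℂ} {N : ℕ}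
    (hN : ∀ᶠ r in l, (f r).totalDegree ≤ N) (hf : ∀ᶠ r in l, IsStable (f r))
    (hlim : ∀ z : σ → ℂ, (∀ i, 0 < (z i).im) →
      Filter.Tendsto (fun r => eval z (f r)) l (nhds (eval z F))) :
    IsStable F ∨ F = 0 := by
  cases nonempty_fintype σ
  by_contra! hcon
  obtain ⟨hns, hF⟩ := hcon
  simp only [IsStable, not_forall, not_not] at hns
  obtain ⟨z, hz, hzF⟩ := hns
  apply hF
  obtain ⟨δ, hδ, hδz⟩ : ∃ δ > 0, ∀ i, δ < (z i).im := by
    rcases isEmpty_or_nonempty σ with h | h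
    · exact ⟨1, one_pos, fun i => h.elim i⟩
    · obtain ⟨i, hi⟩ := Finite.exists_min fun i => (z i).im
      exact ⟨(z i).im / 2, half_pos (hz i), fun j => (half_lt_self (hz i)).trans_le (hi j)⟩
  refine funext_set (fun i => Metric.ball (z i) δ)
    (fun i => infinite_of_mem_nhds (z i) (Metric.ball_mem_nhds _ hδ)) fun w hw => ?_
  rw [map_zero]
  have hline : ∀ t : ℂ, ‖t‖ ≤ 1 → ∀ i, 0 < (z i + (w i - z i) * t).im := by
    intro t ht i
    have h1 : ‖w i - z i‖ < δ := by simpa [dist_eq_norm] using hw i trivial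
    have h2 : |((w i - z i) * t).im| ≤ ‖w i - z i‖ * ‖t‖ := by
      rw [← norm_mul]; exact Complex.abs_im_le_norm _
    have h3 : ‖w i - z i‖ * ‖t‖ ≤ ‖w i - z i‖ :=
      mul_le_of_le_one_right (norm_nonneg _) ht
    rw [Complex.add_im]
    linarith [(abs_le.1 h2).1, hδz i]
  have hw' : ∀ i, 0 < (w i).im := by
    intro i
    simpa using hline 1 (by simp) i
  have hbound : ∀ᶠ r in l, ‖eval w (f r)‖ ≤ 2 ^ N * ‖eval z (f r)‖ := by
    filter_upwards [hN, hf] with r h1 h2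
    have := Polynomial.norm_eval_le_two_pow_mul (p := (f r).onLine z (fun i => w i - z i))
      ((natDegree_onLine_le _ _ _).trans h1)
      (fun t ht => by rw [eval_onLine]; exact h2 _ (hline t ht.le)) (t := 1) (by simp)
    simpa [eval_onLine] using this
  have h0 := le_of_tendsto_of_tendsto (hlim w hw').norm
    ((hlim z hz).norm.const_mul ((2 : ℝ) ^ N)) hbound
  rw [hzF] at h0
  simpa using h0

lemma MvPolynomial.aeval_conj {σ : Type*} (f : MvPolynomial σ ℝ) (z : σ → ℂ) :
    aeval (fun i => (starRingEnd ℂ) (z i)) f = (starRingEnd ℂ) (aeval z f) := by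
  rw [aeval_def, aeval_def, hom_eval₂]
  congr 1
  ext; simp

lemma MvPolynomial.eval_map_algebraMap_complex {σ : Type*} (f : MvPolynomial σ ℝ) (z : σ → ℂ) :
    eval z (map (algebraMap ℝ ℂ) f) = aeval z f := by
  rw [eval_map, aeval_def]

/-- The Hermite–Biehler inequality. -/
lemma norm_sub_I_mul_le_of_forall_ne_zero {σ : Type*} {f g : MvPolynomial σ ℝ}
    (h : ∀ z : σ → ℂ, (∀ i, 0 < (z i).im) → aeval z f + Complex.I * aeval z g ≠ 0)
    {z : σ → ℂ} (hz : ∀ i, 0 < (z i).im) :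
    ‖aeval z f - Complex.I * aeval z g‖ ≤ ‖aeval z f + Complex.I * aeval z g‖ := by
  set p : Polynomial ℂ := (map (algebraMap ℝ ℂ) f + C Complex.I * map (algebraMap ℝ ℂ) g).onLine
    (fun j => ((z j).re : ℂ)) (fun j => ((z j).im : ℂ)) with hp
  have hev : ∀ t, p.eval t = aeval (fun j => ((z j).re : ℂ) + (z j).im * t) f +
      Complex.I * aeval (fun j => ((z j).re : ℂ) + (z j).im * t) g := by
    intro t
    rw [hp, eval_onLine]
    simp only [map_add, map_mul, eval_C, eval_map_algebraMap_complex]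
  have key := Polynomial.norm_eval_neg_I_le (p := p) fun t ht => by
    rw [hev]
    refine h _ fun i => ?_
    simpa using mul_pos (hz i) ht
  rw [hev, hev] at key
  have h1 : (fun j => ((z j).re : ℂ) + (z j).im * Complex.I) = z := by
    ext j; exact Complex.re_add_im _
  have h2 : (fun j => ((z j).re : ℂ) + (z j).im * -Complex.I) =
      fun j => (starRingEnd ℂ) (z j) := by
    ext j
    apply Complex.ext <;> simp
  rw [h1, h2, aeval_conj, aeval_conj] at key
  have h3 : (starRingEnd ℂ) (aeval z f - Complex.I * aeval z g) =
      (starRingEnd ℂ) (aeval z f) + Complex.I * (starRingEnd ℂ) (aeval z g) := by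
    simp
  rwa [← h3, RCLike.norm_conj] at key

/-- The Hermite–Biehler theorem: the real part of a stable polynomial is stable or zero. -/
lemma isRealStable_or_eq_zero_of_forall_ne_zero {σ : Type*} [Finite σ] {f g : MvPolynomial σ ℝ}
    (h : ∀ z : σ → ℂ, (∀ i, 0 < (z i).im) → aeval z f + Complex.I * aeval z g ≠ 0) :
    IsRealStable f ∨ f = 0 := by
  have hr : ∀ r : ℝ, 0 < r → IsStable (map (algebraMap ℝ ℂ) f +
      C (r * Complex.I) * map (algebraMap ℝ ℂ) g) := by
    intro r hr z hz h0
    simp only [map_add, map_mul, eval_C, eval_map_algebraMap_complex] at h0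
    have hle := norm_sub_I_mul_le_of_forall_ne_zero h hz
    have hne := h z hz
    rw [eq_neg_of_add_eq_zero_left h0] at hle hne
    have e1 : -(r * Complex.I * aeval z g) - Complex.I * aeval z g =
        ((-(1 + r) : ℝ) : ℂ) * (Complex.I * aeval z g) := by push_cast; ring
    have e2 : -(r * Complex.I * aeval z g) + Complex.I * aeval z g =
        ((1 - r : ℝ) : ℂ) * (Complex.I * aeval z g) := by push_cast; ring
    rw [e1, e2, norm_mul ((-(1 + r) : ℝ) : ℂ), norm_mul ((1 - r : ℝ) : ℂ), Complex.norm_real,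
      Complex.norm_real] at hle
    rw [e2] at hne
    have hpos : 0 < ‖Complex.I * aeval z g‖ := norm_pos_iff.2 (right_ne_zero_of_mul hne)
    have := le_of_mul_le_mul_right hle hpos
    rw [Real.norm_eq_abs, Real.norm_eq_abs, abs_neg, abs_of_pos (by linarith)] at this
    rcases abs_cases (1 - r) with h | h <;> linarith
  have := isStable_or_eq_zero_of_tendsto (l := nhdsWithin (0 : ℝ) (Set.Ioi 0))
    (f := fun r : ℝ => map (algebraMap ℝ ℂ) f + C (r * Complex.I) * map (algebraMap ℝ ℂ) g)
    (F := map (algebraMap ℝ ℂ) f)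
    (N := max (map (algebraMap ℝ ℂ) f).totalDegree (map (algebraMap ℝ ℂ) g).totalDegree)
    (Filter.Eventually.of_forall fun r => (totalDegree_add _ _).trans <|
      max_le_max le_rfl <| (totalDegree_mul _ _).trans (by rw [totalDegree_C, zero_add]))
    (by filter_upwards [self_mem_nhdsWithin] with r hr' using hr r hr')
    (fun z _ => by
      refine tendsto_nhdsWithin_of_tendsto_nhds ?_
      have : Continuous fun r : ℝ => eval z (map (algebraMap ℝ ℂ) f +
          C (r * Complex.I) * map (algebraMap ℝ ℂ) g) := by
        simp only [map_add, map_mul, eval_C]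
        fun_prop
      simpa using this.tendsto 0)
  refine this.imp (fun h z hz => ?_) fun h => ?_
  · rw [← eval_map_algebraMap_complex]
    exact h z hz
  · exact (map_eq_zero_iff _ (map_injective _ (algebraMap ℝ ℂ).injective)).1 h

/-- Laguerre's theorem on polar derivatives, for the closed unit disc. -/
lemma Polynomial.polar_ne_zero {p : Polynomial ℂ} {k : ℕ} (hk : 0 < k) (hpk : p.natDegree ≤ k)
    (hp : ∀ w : ℂ, ‖w‖ ≤ 1 → p.eval w ≠ 0) {w v : ℂ} (hw : ‖w‖ ≤ 1) (hv : ‖v‖ ≤ 1) :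
    k * p.eval w + (v - w) * p.derivative.eval w ≠ 0 := by
  have hs := IsAlgClosed.splits p
  have h0 : p ≠ 0 := by
    rintro rfl
    exact hp 0 (by simp) (by simp)
  have hroot : ∀ a ∈ p.roots, 1 < ‖a‖ := by
    intro a ha
    by_contra! h
    exact hp a h ((Polynomial.mem_roots h0).1 ha)
  have hpw := hp w hw
  set S : ℂ := (p.roots.map fun a => 1 / (w - a)).sum with hS
  have hder : p.derivative.eval w = S * p.eval w := by
    have := hs.eval_derivative_div_eval_of_ne_zero hpw
    rw [div_eq_iff hpw] at this
    exact this
  have hcard : p.roots.card ≤ k := p.card_roots'.trans hpk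
  have hw1 : 0 ≤ 1 - Complex.normSq w := by
    rw [Complex.normSq_eq_norm_sq]
    nlinarith [norm_nonneg w]
  have hterm : ∀ a : ℂ, 1 < ‖a‖ →
      (1 - Complex.normSq w) * Complex.normSq (1 / (w - a)) + 2 * (w * (1 / (w - a))).re < 1 := by
    intro a ha
    have hwa : w - a ≠ 0 := by
      intro h
      rw [sub_eq_zero.1 h] at hw
      linarith
    have h1 : 1 - w * (1 / (w - a)) = -a * (1 / (w - a)) := by field_simp; ring
    have h2 := congrArg Complex.normSq h1
    rw [Complex.normSq_sub, map_mul Complex.normSq (-a), map_mul Complex.normSq w,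
      Complex.normSq_neg, map_one, one_mul, Complex.conj_re] at h2
    have h3 : 1 < Complex.normSq a := by
      rw [Complex.normSq_eq_norm_sq]
      nlinarith
    have h4 : 0 < Complex.normSq (1 / (w - a)) := Complex.normSq_pos.2 (by simpa using hwa)
    nlinarith
  have hsum : ∀ m : Multiset ℂ, (∀ a ∈ m, 1 < ‖a‖) → 0 < m.card →
      (1 - Complex.normSq w) * Complex.normSq (m.map fun a => 1 / (w - a)).sum +
        2 * m.card * (w * (m.map fun a => 1 / (w - a)).sum).re < (m.card : ℝ) ^ 2 := by
    intro m
    induction m using Multiset.induction_on with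
    | empty => simp
    | cons a m ih =>
      intro hm _
      have ha := hterm a (hm a (Multiset.mem_cons_self a m))
      rcases Nat.eq_zero_or_pos m.card with h0 | h0
      · rw [Multiset.card_eq_zero] at h0
        subst h0
        simpa using ha
      · have hm' := ih (fun b hb => hm b (Multiset.mem_cons_of_mem hb)) h0
        have hd : (0 : ℝ) < m.card := by exact_mod_cast h0
        rw [Multiset.map_cons, Multiset.sum_cons, Multiset.card_cons, mul_add, Complex.add_re]
        push_cast
        generalize (m.map fun a => 1 / (w - a)).sum = x at *
        generalize 1 / (w - a) = y at *
        generalize (m.card : ℝ) = d at *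
        have hxy : d * Complex.normSq (y + x) ≤
            (d + 1) * Complex.normSq x + d * (d + 1) * Complex.normSq y := by
          simp only [Complex.normSq_apply, Complex.add_re, Complex.add_im]
          nlinarith [sq_nonneg (x.re - d * y.re), sq_nonneg (x.im - d * y.im)]
        refine lt_of_mul_lt_mul_left (a := d) ?_ hd.le
        have h1 := mul_le_mul_of_nonneg_left hxy hw1
        have h2 := mul_lt_mul_of_pos_left hm' (by linarith : (0 : ℝ) < d + 1)
        have h3 := mul_lt_mul_of_pos_left ha (by nlinarith : (0 : ℝ) < d * (d + 1))
        linarith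
  have hk' : (0 : ℝ) < k := by exact_mod_cast hk
  have hfin : (1 - Complex.normSq w) * Complex.normSq S + 2 * k * (w * S).re < (k : ℝ) ^ 2 := by
    rcases Nat.eq_zero_or_pos p.roots.card with hd0 | hd0
    · rw [Multiset.card_eq_zero] at hd0
      rw [hS, hd0]
      simpa using pow_pos hk' 2
    · have h1 := hsum p.roots hroot hd0
      rw [← hS] at h1
      have hd : (0 : ℝ) < p.roots.card := by exact_mod_cast hd0
      have hdk : (p.roots.card : ℝ) ≤ k := by exact_mod_cast hcard
      generalize (p.roots.card : ℝ) = d at *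
      have hE : 0 ≤ (1 - Complex.normSq w) * Complex.normSq S :=
        mul_nonneg hw1 (Complex.normSq_nonneg _)
      generalize (1 - Complex.normSq w) * Complex.normSq S = E at *
      refine lt_of_mul_lt_mul_left (a := d) ?_ hd.le
      have h2 := mul_lt_mul_of_pos_left h1 hk'
      nlinarith [mul_le_mul_of_nonneg_right hdk hE,
        mul_le_mul_of_nonneg_left hdk (mul_pos hd hk').le]
  rw [hder]
  intro h
  have h1 : p.eval w * (k + (v - w) * S) = 0 := by rw [← h]; ring
  have h2 : v * S = -(k - w * S) := by
    have := (mul_eq_zero.1 h1).resolve_left hpw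
    linear_combination this
  have h3 := congrArg Complex.normSq h2
  rw [Complex.normSq_neg, Complex.normSq_sub, map_mul, map_mul, Complex.normSq_natCast] at h3
  have h4 : Complex.normSq v ≤ 1 := by
    rw [Complex.normSq_eq_norm_sq]
    nlinarith [norm_nonneg v]
  have h5 : ((k : ℂ) * (starRingEnd ℂ) (w * S)).re = k * (w * S).re := by simp
  rw [h5] at h3
  nlinarith [Complex.normSq_nonneg S]

lemma biaffine_diag_ne_zero {a b c d : ℂ}
    (h : ∀ u w : ℂ, ‖u‖ ≤ 1 → ‖w‖ ≤ 1 → a + b * u + c * w + d * (u * w) ≠ 0) : a + d ≠ 0 := by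
  intro had
  have aux : ∀ b c : ℂ, (∀ u w : ℂ, ‖u‖ ≤ 1 → ‖w‖ ≤ 1 → a + b * u + c * w + d * (u * w) ≠ 0) →
      ‖c‖ < ‖b‖ := by
    intro b c h
    have key : ∀ u : ℂ, ‖u‖ = 1 → ‖c + d * u‖ < ‖a + b * u‖ := by
      intro u hu
      by_contra! hle
      by_cases h0 : c + d * u = 0
      · have h1 : a + b * u = 0 := by simpa [h0] using hle
        exact h u 0 hu.le (by simp) (by simp [h1])
      · refine h u (-(a + b * u) / (c + d * u)) hu.le ?_ ?_
        · rw [norm_div, norm_neg]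
          exact div_le_one_of_le₀ hle (norm_nonneg _)
        · have := div_mul_cancel₀ (-(a + b * u)) h0
          linear_combination this
    have k1 := key 1 (by simp)
    have k2 := key (-1) (by simp)
    have hd : d = -a := (eq_neg_of_add_eq_zero_right had)
    have q1 := parallelogram_law_with_norm ℝ c a
    have q2 := parallelogram_law_with_norm ℝ a b
    rw [hd] at k1 k2
    have e1 : c + -a * 1 = c - a := by ring
    have e2 : c + -a * -1 = c + a := by ring
    have e3 : a + b * 1 = a + b := by ring
    have e4 : a + b * -1 = a - b := by ring
    rw [e1, e3] at k1
    rw [e2, e4] at k2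
    by_contra! hbc
    nlinarith [norm_nonneg (c - a), norm_nonneg (c + a), norm_nonneg b, norm_nonneg c]
  have h1 := aux b c h
  have h2 := aux c b fun u w hu hw h0 => h w u hw hu (by rw [← h0]; ring)
  exact lt_asymm h1 h2

lemma sum_polar_ne_zero {c : ℕ → ℂ} {k : ℕ}
    (h : ∀ w : ℂ, ‖w‖ ≤ 1 → ∑ b ∈ Finset.range (k + 2), c b * w ^ b ≠ 0)
    {w v : ℂ} (hw : ‖w‖ ≤ 1) (hv : ‖v‖ ≤ 1) :
    ∑ b ∈ Finset.range (k + 2), c b * (((k + 1 : ℂ) - b) * w ^ b + b * w ^ (b - 1) * v) ≠ 0 := by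
  set p : Polynomial ℂ := ∑ b ∈ Finset.range (k + 2), Polynomial.C (c b) * Polynomial.X ^ b with hp
  have hev : ∀ w, p.eval w = ∑ b ∈ Finset.range (k + 2), c b * w ^ b := by
    intro w
    simp [hp, Polynomial.eval_finsetSum]
  have hder : p.derivative.eval w = ∑ b ∈ Finset.range (k + 2), c b * (b * w ^ (b - 1)) := by
    simp [hp, Polynomial.eval_finsetSum, Polynomial.derivative_X_pow]
  have hdeg : p.natDegree ≤ k + 1 := by
    refine Polynomial.natDegree_sum_le_of_forall_le _ _ fun b hb => ?_
    refine (Polynomial.natDegree_C_mul_X_pow_le _ _).trans ?_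
    have := Finset.mem_range.1 hb
    omega
  have key := Polynomial.polar_ne_zero k.succ_pos hdeg (fun w hw => by rw [hev]; exact h w hw) hw hv
  rw [hev, hder, Finset.mul_sum, Finset.mul_sum, ← Finset.sum_add_distrib] at key
  convert key using 2 with b hb
  rcases b with _ | b
  · simp; ring
  · simp only [Nat.add_sub_cancel, pow_succ]
    push_cast
    ring

lemma sum_diag_div_choose_ne_zero (k : ℕ) : ∀ c : ℕ → ℕ → ℂ,
    (∀ u w : ℂ, ‖u‖ ≤ 1 → ‖w‖ ≤ 1 →
      ∑ a ∈ Finset.range (k + 1), ∑ b ∈ Finset.range (k + 1), c a b * u ^ a * w ^ b ≠ 0) →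
    ∑ a ∈ Finset.range (k + 1), c a a / k.choose a ≠ 0 := by
  induction k with
  | zero =>
    intro c h
    simpa using h 0 0 (by simp) (by simp)
  | succ k ih =>
    intro c h
    have h1 : ∀ u w w' : ℂ, ‖u‖ ≤ 1 → ‖w‖ ≤ 1 → ‖w'‖ ≤ 1 →
        ∑ b ∈ Finset.range (k + 2), (∑ a ∈ Finset.range (k + 2), c a b * u ^ a) *
          (((k + 1 : ℂ) - b) * w ^ b + b * w ^ (b - 1) * w') ≠ 0 := by
      intro u w w' hu hw hw'
      refine sum_polar_ne_zero (fun w hw => ?_) hw hw'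
      convert h u w hu hw using 1
      rw [Finset.sum_comm]
      simp only [Finset.sum_mul]
    have h2 : ∀ u u' w w' : ℂ, ‖u‖ ≤ 1 → ‖u'‖ ≤ 1 → ‖w‖ ≤ 1 → ‖w'‖ ≤ 1 →
        ∑ a ∈ Finset.range (k + 2), (∑ b ∈ Finset.range (k + 2), c a b *
          (((k + 1 : ℂ) - b) * w ^ b + b * w ^ (b - 1) * w')) *
          (((k + 1 : ℂ) - a) * u ^ a + a * u ^ (a - 1) * u') ≠ 0 := by
      intro u u' w w' hu hu' hw hw'
      refine sum_polar_ne_zero (fun u hu => ?_) hu hu'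
      convert h1 u w w' hu hw hw' using 1
      simp only [Finset.sum_mul]
      rw [Finset.sum_comm]
      refine Finset.sum_congr rfl fun _ _ => Finset.sum_congr rfl fun _ _ => ?_
      ring
    have h3 : ∀ u w : ℂ, ‖u‖ ≤ 1 → ‖w‖ ≤ 1 →
        ∑ a ∈ Finset.range (k + 2), ∑ b ∈ Finset.range (k + 2), c a b *
          (((k + 1 : ℂ) - a) * u ^ a * (((k + 1 : ℂ) - b) * w ^ b)) +
        ∑ a ∈ Finset.range (k + 2), ∑ b ∈ Finset.range (k + 2), c a b *
          (a * u ^ (a - 1) * (b * w ^ (b - 1))) ≠ 0 := by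
      intro u w hu hw
      refine biaffine_diag_ne_zero
        (b := ∑ a ∈ Finset.range (k + 2), ∑ b ∈ Finset.range (k + 2), c a b *
          (a * u ^ (a - 1) * (((k + 1 : ℂ) - b) * w ^ b)))
        (c := ∑ a ∈ Finset.range (k + 2), ∑ b ∈ Finset.range (k + 2), c a b *
          (((k + 1 : ℂ) - a) * u ^ a * (b * w ^ (b - 1)))) fun u' w' hu' hw' => ?_
      convert h2 u u' w w' hu hu' hw hw' using 1
      simp only [Finset.sum_mul, ← Finset.sum_add_distrib]
      refine Finset.sum_congr rfl fun _ _ => Finset.sum_congr rfl fun _ _ => ?_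
      ring
    have h4 := ih (fun a b => ((k + 1 : ℂ) - a) * ((k + 1 : ℂ) - b) * c a b +
      (a + 1) * (b + 1) * c (a + 1) (b + 1)) fun u w hu hw => by
        convert h3 u w hu hw using 1
        have e1 : ∑ a ∈ Finset.range (k + 2), ∑ b ∈ Finset.range (k + 2), c a b *
            (((k + 1 : ℂ) - a) * u ^ a * (((k + 1 : ℂ) - b) * w ^ b)) =
            ∑ a ∈ Finset.range (k + 1), ∑ b ∈ Finset.range (k + 1), c a b *
            (((k + 1 : ℂ) - a) * u ^ a * (((k + 1 : ℂ) - b) * w ^ b)) := by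
          rw [Finset.sum_range_succ]
          simp [Finset.sum_range_succ _ (k + 1)]
        have e2 : ∑ a ∈ Finset.range (k + 2), ∑ b ∈ Finset.range (k + 2), c a b *
            (a * u ^ (a - 1) * (b * w ^ (b - 1))) =
            ∑ a ∈ Finset.range (k + 1), ∑ b ∈ Finset.range (k + 1), c (a + 1) (b + 1) *
            ((a + 1) * u ^ a * ((b + 1) * w ^ b)) := by
          rw [Finset.sum_range_succ']
          simp [Finset.sum_range_succ' _ (k + 1)]
        rw [e1, e2]
        simp only [← Finset.sum_add_distrib]
        refine Finset.sum_congr rfl fun _ _ => Finset.sum_congr rfl fun _ _ => ?_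
        ring
    have h5 : ∑ a ∈ Finset.range (k + 1), (((k + 1 : ℂ) - a) * ((k + 1 : ℂ) - a) * c a a +
        (a + 1) * (a + 1) * c (a + 1) (a + 1)) / k.choose a =
        (k + 1) ^ 2 * ∑ a ∈ Finset.range (k + 2), c a a / (k + 1).choose a := by
      have e1 : ∀ a ∈ Finset.range (k + 1), (((k + 1 : ℂ) - a) * ((k + 1 : ℂ) - a) * c a a +
          (a + 1) * (a + 1) * c (a + 1) (a + 1)) / k.choose a =
          (k + 1) * (((k + 1 : ℂ) - a) * (c a a / (k + 1).choose a)) +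
          (k + 1) * ((a + 1) * (c (a + 1) (a + 1) / (k + 1).choose (a + 1))) := by
        intro a ha
        have hak : a ≤ k := by have := Finset.mem_range.1 ha; omega
        have p1 : (k.choose a : ℂ) ≠ 0 := by exact_mod_cast (Nat.choose_pos hak).ne'
        have p2 : ((k + 1).choose a : ℂ) ≠ 0 := by
          exact_mod_cast (Nat.choose_pos (by omega : a ≤ k + 1)).ne'
        have p3 : ((k + 1).choose (a + 1) : ℂ) ≠ 0 := by
          exact_mod_cast (Nat.choose_pos (by omega : a + 1 ≤ k + 1)).ne'
        have q1 : (k.choose a : ℂ) * (k + 1) = (k + 1).choose a * ((k + 1 : ℂ) - a) := by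
          have := Nat.choose_mul_succ_eq k a
          have h := congrArg (Nat.cast : ℕ → ℂ) this
          rw [Nat.cast_mul, Nat.cast_mul, Nat.cast_sub (by omega)] at h
          push_cast at h
          exact h
        have q2 : ((k + 1 : ℂ)) * k.choose a = (k + 1).choose (a + 1) * (a + 1) := by
          exact_mod_cast Nat.add_one_mul_choose_eq k a
        have r1 : ((k + 1 : ℂ) - a) / k.choose a = (k + 1) / (k + 1).choose a := by
          rw [div_eq_div_iff p1 p2]; linear_combination -q1
        have r2 : ((a + 1 : ℂ)) / k.choose a = (k + 1) / (k + 1).choose (a + 1) := by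
          rw [div_eq_div_iff p1 p3]; linear_combination -q2
        linear_combination ((k + 1 : ℂ) - a) * c a a * r1 + (a + 1) * c (a + 1) (a + 1) * r2
      rw [Finset.sum_congr rfl e1, Finset.sum_add_distrib, ← Finset.mul_sum, ← Finset.mul_sum,
        ← mul_add]
      have e2 : ∑ a ∈ Finset.range (k + 1), ((k + 1 : ℂ) - a) * (c a a / (k + 1).choose a) =
          ∑ a ∈ Finset.range (k + 2), ((k + 1 : ℂ) - a) * (c a a / (k + 1).choose a) := by
        rw [Finset.sum_range_succ _ (k + 1)]
        simp
      have e3 : ∑ a ∈ Finset.range (k + 1), ((a : ℂ) + 1) *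
          (c (a + 1) (a + 1) / (k + 1).choose (a + 1)) =
          ∑ a ∈ Finset.range (k + 2), (a : ℂ) * (c a a / (k + 1).choose a) := by
        rw [Finset.sum_range_succ' _ (k + 1)]
        simp
      rw [e2, e3, ← Finset.sum_add_distrib, pow_two, mul_assoc]
      congr 1
      rw [Finset.mul_sum]
      refine Finset.sum_congr rfl fun _ _ => ?_
      ring
    rw [h5] at h4
    exact right_ne_zero_of_mul h4

lemma sum_ite_div_choose_ne_zero {τ : Type*} {J : Finset τ} {x : τ → ℂ} {p q : τ → ℕ} {k : ℕ}
    (hp : ∀ j ∈ J, p j ≤ k) (hq : ∀ j ∈ J, q j ≤ k)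
    (h : ∀ u w : ℂ, ‖u‖ ≤ 1 → ‖w‖ ≤ 1 → ∑ j ∈ J, x j * (u ^ p j * w ^ q j) ≠ 0) :
    ∑ j ∈ J, x j * (if p j = q j then 1 / (k.choose (p j) : ℂ) else 0) ≠ 0 := by
  have key := sum_diag_div_choose_ne_zero k
    (fun a b => ∑ j ∈ J, if p j = a ∧ q j = b then x j else 0) fun u w hu hw => by
      convert h u w hu hw using 1
      simp only [Finset.sum_mul]
      simp_rw [Finset.sum_comm (t := J)]
      refine Finset.sum_congr rfl fun j hj => ?_
      rw [Finset.sum_eq_single (p j), Finset.sum_eq_single (q j)]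
      · simp [mul_assoc]
      · intro b _ hb
        simp [hb.symm]
      · intro hb
        exact absurd (Finset.mem_range.2 (Nat.lt_succ_of_le (hq j hj))) hb
      · intro a _ ha
        simp [ha.symm]
      · intro ha
        exact absurd (Finset.mem_range.2 (Nat.lt_succ_of_le (hp j hj))) ha
  convert key using 1
  simp only [Finset.sum_div]
  rw [Finset.sum_comm]
  refine Finset.sum_congr rfl fun j hj => ?_
  rw [Finset.sum_eq_single (p j)]
  · by_cases hpq : p j = q j
    · simp [hpq, div_eq_mul_inv]
    · simp [hpq, Ne.symm hpq]
  · intro a _ ha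
    simp [ha.symm]
  · intro ha
    exact absurd (Finset.mem_range.2 (Nat.lt_succ_of_le (hp j hj))) ha

/-- A multivariate Grace-type theorem for the closed unit polydisc. -/
lemma sum_prod_ite_div_choose_ne_zero {σ τ : Type*} [Fintype σ] {J : Finset τ} {x : τ → ℂ}
    {p q : τ → σ → ℕ} {κ : σ → ℕ} (hp : ∀ j ∈ J, ∀ i, p j i ≤ κ i) (hq : ∀ j ∈ J, ∀ i, q j i ≤ κ i)
    (h : ∀ u w : σ → ℂ, (∀ i, ‖u i‖ ≤ 1) → (∀ i, ‖w i‖ ≤ 1) →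
      ∑ j ∈ J, x j * ∏ i, (u i ^ p j i * w i ^ q j i) ≠ 0) :
    ∑ j ∈ J, x j * ∏ i, (if p j i = q j i then 1 / ((κ i).choose (p j i) : ℂ) else 0) ≠ 0 := by
  classical
  have key : ∀ S : Finset σ, ∀ u w : σ → ℂ, (∀ i, ‖u i‖ ≤ 1) → (∀ i, ‖w i‖ ≤ 1) →
      ∑ j ∈ J, x j * ((∏ i ∈ S, if p j i = q j i then 1 / ((κ i).choose (p j i) : ℂ) else 0) *
        ∏ i ∈ Sᶜ, (u i ^ p j i * w i ^ q j i)) ≠ 0 := by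
    intro S
    induction S using Finset.induction_on with
    | empty => simpa using h
    | insert s S hs ih =>
      intro u w hu hw
      have := sum_ite_div_choose_ne_zero (J := J) (k := κ s) (p := fun j => p j s)
        (q := fun j => q j s)
        (x := fun j => x j * ((∏ i ∈ S, if p j i = q j i then
          1 / ((κ i).choose (p j i) : ℂ) else 0) *
          ∏ i ∈ (insert s S)ᶜ, (u i ^ p j i * w i ^ q j i)))
        (fun j hj => hp j hj s) (fun j hj => hq j hj s) fun a b ha hb => by
          convert ih (Function.update u s a) (Function.update w s b) ?_ ?_ using 1
          · refine Finset.sum_congr rfl fun j hj => ?_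
            have hc : Sᶜ = insert s (insert s S)ᶜ := by
              ext i
              by_cases his : i = s <;> simp [his, hs]
            rw [hc, Finset.prod_insert (by simp)]
            have : ∏ i ∈ (insert s S)ᶜ, (Function.update u s a i ^ p j i *
                Function.update w s b i ^ q j i) =
                ∏ i ∈ (insert s S)ᶜ, (u i ^ p j i * w i ^ q j i) := by
              refine Finset.prod_congr rfl fun i hi => ?_
              have : i ≠ s := by
                rintro rfl
                simp at hi
              simp [this]
            rw [this]
            simp only [Function.update_self]
            ring
          · intro i
            by_cases his : i = s
            · subst his; simpa using ha
            · simpa [his] using hu i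
          · intro i
            by_cases his : i = s
            · subst his; simpa using hb
            · simpa [his] using hw i
      convert this using 1
      refine Finset.sum_congr rfl fun j hj => ?_
      rw [Finset.prod_insert hs]
      ring
  simpa using key Finset.univ 0 0 (by simp) (by simp)

lemma prod_sum_range_eq_sum_Iic {σ A : Type*} [Fintype σ] [DecidableEq σ] [CommSemiring A]
    (κ : σ →₀ ℕ) (F : σ → ℕ → A) :
    ∏ i, ∑ a ∈ Finset.range (κ i + 1), F i a = ∑ β ∈ Finset.Iic κ, ∏ i, F i (β i) := by
  rw [Finset.prod_univ_sum]
  refine (Finset.sum_equiv Finsupp.equivFunOnFinite (fun β => ?_) fun β _ => ?_).symm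
  · simp [Finsupp.le_def, Fintype.mem_piFinset]
  · simp

lemma prod_add_pow_eq_sum_Iic {σ A : Type*} [Fintype σ] [DecidableEq σ] [CommSemiring A]
    (κ : σ →₀ ℕ) (x y : σ → A) :
    ∏ i, (x i + y i) ^ κ i = ∑ β ∈ Finset.Iic κ,
      ((∏ i, (κ i).choose (β i) : ℕ) : A) * ∏ i, (x i ^ β i * y i ^ (κ i - β i)) := by
  simp_rw [add_pow]
  rw [prod_sum_range_eq_sum_Iic]
  refine Finset.sum_congr rfl fun β _ => ?_
  rw [Nat.cast_prod, ← Finset.prod_mul_distrib]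
  refine Finset.prod_congr rfl fun i _ => ?_
  ring

lemma MvPolynomial.monomial_one_eq_prod {σ A : Type*} [Fintype σ] [CommSemiring A] (β : σ →₀ ℕ) :
    (monomial β 1 : MvPolynomial σ A) = ∏ i, X i ^ β i := by
  rw [monomial_eq, C_1, one_mul, Finsupp.prod_fintype _ _ (by simp)]

lemma exists_linear_mul_sum_eq (k : ℕ) (c : ℕ → ℂ) (p q : ℂ) : ∃ c' : ℕ → ℂ,
    ∀ (A : Type) [CommRing A] [Algebra ℂ A] (x y : A),
      (p • x + q • y) * ∑ a ∈ Finset.range (k + 1), c a • (y ^ a * x ^ (k - a)) =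
        ∑ a ∈ Finset.range (k + 2), c' a • (y ^ a * x ^ (k + 1 - a)) := by
  refine ⟨fun a => p * (if a ≤ k then c a else 0) + q * (if a = 0 then 0 else c (a - 1)),
    fun A _ _ x y => ?_⟩
  simp only [add_smul, Finset.sum_add_distrib, add_mul, Finset.mul_sum]
  congr 1
  · rw [Finset.sum_range_succ _ (k + 1)]
    simp only [Nat.not_succ_le_self, if_false, mul_zero, zero_smul, add_zero]
    refine Finset.sum_congr rfl fun a ha => ?_
    have hak : a ≤ k := Nat.lt_succ_iff.1 (Finset.mem_range.1 ha)
    rw [if_pos hak, Nat.succ_sub hak, pow_succ, mul_smul, smul_mul_smul_comm, ← mul_smul]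
    congr 1
    ring
  · rw [Finset.sum_range_succ' _ (k + 1)]
    simp only [if_true, mul_zero, zero_smul, add_zero, Nat.succ_ne_zero, if_false]
    refine Finset.sum_congr rfl fun a ha => ?_
    rw [smul_mul_smul_comm, Nat.add_sub_cancel, Nat.add_sub_add_right, pow_succ]
    congr 1
    ring

lemma exists_pow_mul_pow_eq_sum (p q r s : ℂ) (b m : ℕ) : ∃ c : ℕ → ℂ,
    ∀ (A : Type) [CommRing A] [Algebra ℂ A] (x y : A),
      (p • x + q • y) ^ b * (r • x + s • y) ^ m =
        ∑ a ∈ Finset.range (b + m + 1), c a • (y ^ a * x ^ (b + m - a)) := by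
  induction b with
  | zero =>
    induction m with
    | zero => exact ⟨fun _ => 1, fun A _ _ x y => by simp⟩
    | succ m ih =>
      obtain ⟨c, hc⟩ := ih
      obtain ⟨c', hc'⟩ := exists_linear_mul_sum_eq (0 + m) c r s
      refine ⟨c', fun A _ _ x y => ?_⟩
      rw [← add_assoc, ← hc', ← hc]
      ring
  | succ b ih =>
    obtain ⟨c, hc⟩ := ih
    obtain ⟨c', hc'⟩ := exists_linear_mul_sum_eq (b + m) c p q
    refine ⟨c', fun A _ _ x y => ?_⟩
    rw [add_right_comm b 1 m, ← hc', ← hc]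
    ring

lemma exists_prod_eq_sum_Iic {σ : Type*} [Fintype σ] [DecidableEq σ] (p q r s : ℂ)
    {κ β : σ →₀ ℕ} (hβ : β ≤ κ) : ∃ d : (σ →₀ ℕ) → ℂ,
    ∀ (A : Type) [CommRing A] [Algebra ℂ A] (x y : σ → A),
      ∏ i, ((p • x i + q • y i) ^ β i * (r • x i + s • y i) ^ (κ i - β i)) =
        ∑ α ∈ Finset.Iic κ, d α • ∏ i, (y i ^ α i * x i ^ (κ i - α i)) := by
  choose c hc using fun i => exists_pow_mul_pow_eq_sum p q r s (β i) (κ i - β i)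
  refine ⟨fun α => ∏ i, c i (α i), fun A _ _ x y => ?_⟩
  have h : ∀ i, β i + (κ i - β i) = κ i := fun i => Nat.add_sub_cancel' (hβ i)
  simp_rw [hc, h]
  rw [prod_sum_range_eq_sum_Iic]
  refine Finset.sum_congr rfl fun α _ => ?_
  simp_rw [Algebra.smul_def, Finset.prod_mul_distrib, map_prod]

lemma Complex.im_cayley_pos {x : ℂ} (hx : ‖x‖ < 1) : 0 < (I * (1 + x) / (1 - x)).im := by
  have hne : 1 - x ≠ 0 := by
    intro h
    rw [← sub_eq_zero.1 h] at hx
    simp at hx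
  have h1 : x.re * x.re + x.im * x.im < 1 := by
    rw [← Complex.normSq_apply, Complex.normSq_eq_norm_sq]
    nlinarith [norm_nonneg x]
  have h2 : 0 < Complex.normSq (1 - x) := Complex.normSq_pos.2 hne
  rw [Complex.div_im, ← sub_div]
  refine div_pos ?_ h2
  simp
  nlinarith

/-- If the symbol of an operator is stable, the operator preserves stability. -/
lemma isStable_sum_smul_of_symbol {σ ρ : Type} [Fintype σ] [DecidableEq σ] [Finite ρ]
    {κ : σ →₀ ℕ} {t : (σ →₀ ℕ) → MvPolynomial ρ ℂ} {c : (σ →₀ ℕ) → ℂ}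
    (hsymb : ∀ (z : ρ → ℂ) (w : σ → ℂ), (∀ i, 0 < (z i).im) → (∀ i, 0 < (w i).im) →
      ∑ β ∈ Finset.Iic κ, ((∏ i, (κ i).choose (β i) : ℕ) : ℂ) * (∏ i, w i ^ (κ i - β i)) *
        eval z (t β) ≠ 0)
    (hc : ∀ u : σ → ℂ, (∀ i, 0 < (u i).im) → ∑ β ∈ Finset.Iic κ, c β * ∏ i, u i ^ β i ≠ 0) :
    IsStable (∑ β ∈ Finset.Iic κ, c β • t β) ∨ ∑ β ∈ Finset.Iic κ, c β • t β = 0 := by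
  set L : MvPolynomial σ ℂ →ₗ[ℂ] MvPolynomial ρ ℂ := (basisMonomials σ ℂ).constr ℂ t with hL
  have hLmon : ∀ β, L (∏ i, X i ^ β i) = t β := by
    intro β
    have := (basisMonomials σ ℂ).constr_basis ℂ t β
    rw [coe_basisMonomials] at this
    rwa [← monomial_one_eq_prod]
  have hd : ∀ β : σ →₀ ℕ, ∃ d : (σ →₀ ℕ) → ℂ, β ≤ κ →
    ∀ (A : Type) [CommRing A] [Algebra ℂ A] (x y : σ → A),
      ∏ i, (((1 / 2 : ℂ) • x i + (1 / 2 : ℂ) • y i) ^ β i *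
        ((-Complex.I / 2) • x i + (Complex.I / 2) • y i) ^ (κ i - β i)) =
        ∑ α ∈ Finset.Iic κ, d α • ∏ i, (y i ^ α i * x i ^ (κ i - α i)) := by
    intro β
    by_cases hβ : β ≤ κ
    · obtain ⟨d, hd⟩ := exists_prod_eq_sum_Iic (1 / 2) (1 / 2) (-Complex.I / 2) (Complex.I / 2) hβ
      exact ⟨d, fun _ => hd⟩
    · exact ⟨0, fun h => absurd h hβ⟩
  choose d hd using hd
  set e : (σ →₀ ℕ) → MvPolynomial σ ℂ := fun α =>
    ∏ i, ((X i - C Complex.I) ^ α i * (X i + C Complex.I) ^ (κ i - α i)) with he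
  set f : (σ →₀ ℕ) → ℂ := fun α => ∑ β ∈ Finset.Iic κ, c β * d β α with hf
  have hsum : ∀ (A : Type) [CommRing A] [Algebra ℂ A] (x y : σ → A),
      ∑ α ∈ Finset.Iic κ, f α • ∏ i, (y i ^ α i * x i ^ (κ i - α i)) =
      ∑ β ∈ Finset.Iic κ, c β • ∏ i, (((1 / 2 : ℂ) • x i + (1 / 2 : ℂ) • y i) ^ β i *
        ((-Complex.I / 2) • x i + (Complex.I / 2) • y i) ^ (κ i - β i)) := by
    intro A _ _ x y
    refine Eq.trans ?_ (Finset.sum_congr rfl fun β hβ =>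
      congrArg (c β • ·) (hd β (Finset.mem_Iic.1 hβ) A x y)).symm
    simp only [hf, Finset.sum_smul, Finset.smul_sum, mul_smul]
    rw [Finset.sum_comm]
  have hcayley : ∑ α ∈ Finset.Iic κ, f α • e α = ∑ β ∈ Finset.Iic κ, c β • ∏ i, X i ^ β i := by
    rw [hsum]
    refine Finset.sum_congr rfl fun β _ => ?_
    congr 1
    refine Finset.prod_congr rfl fun i _ => ?_
    have h1 : ((1 / 2 : ℂ) • (X i + C Complex.I) + (1 / 2 : ℂ) • (X i - C Complex.I) :
        MvPolynomial σ ℂ) = X i := by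
      rw [← smul_add, add_add_sub_cancel, ← two_smul ℂ, smul_smul]
      norm_num
    have h2 : ((-Complex.I / 2) • (X i + C Complex.I) + (Complex.I / 2) • (X i - C Complex.I) :
        MvPolynomial σ ℂ) = 1 := by
      simp only [smul_eq_C_mul]
      have : (C (-Complex.I / 2) + C (Complex.I / 2) : MvPolynomial σ ℂ) = 0 := by
        rw [← C_add]; simp [neg_div]
      have h' : (C (-Complex.I / 2) * C Complex.I - C (Complex.I / 2) * C Complex.I :
          MvPolynomial σ ℂ) = 1 := by
        rw [← C_mul, ← C_mul, ← C_sub, ← C_1]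
        congr 1
        linear_combination -Complex.I_mul_I
      linear_combination X i * this + h'
    rw [h1, h2, one_pow, mul_one]
  have hfne : ∀ x : σ → ℂ, (∀ i, ‖x i‖ < 1) → ∑ α ∈ Finset.Iic κ, f α * ∏ i, x i ^ α i ≠ 0 := by
    intro x hx
    have hne : ∀ i, 1 - x i ≠ 0 := by
      intro i h
      have := hx i
      rw [← sub_eq_zero.1 h] at this
      simp at this
    have h1 := hsum ℂ (fun _ => 1) x
    simp only [one_pow, mul_one, smul_eq_mul] at h1
    rw [h1]
    have h2 : ∀ β ∈ Finset.Iic κ, c β * ∏ i, ((1 / 2 + 1 / 2 * x i) ^ β i *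
        (-Complex.I / 2 + Complex.I / 2 * x i) ^ (κ i - β i)) =
        (∏ i, (-Complex.I / 2 + Complex.I / 2 * x i) ^ κ i) *
          (c β * ∏ i, (Complex.I * (1 + x i) / (1 - x i)) ^ β i) := by
      intro β hβ
      rw [mul_left_comm, ← Finset.prod_mul_distrib]
      congr 1
      refine Finset.prod_congr rfl fun i _ => ?_
      have h3 : (1 / 2 + 1 / 2 * x i : ℂ) = (-Complex.I / 2 + Complex.I / 2 * x i) *
          (Complex.I * (1 + x i) / (1 - x i)) := by
        rw [mul_div_assoc', eq_div_iff (hne i)]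
        linear_combination (1 / 2 * (1 - x i) * (1 + x i)) * Complex.I_mul_I
      rw [h3, mul_pow]
      have h4 : κ i = β i + (κ i - β i) := (Nat.add_sub_cancel' (Finset.mem_Iic.1 hβ i)).symm
      conv_rhs => rw [h4, pow_add]
      ring
    rw [Finset.sum_congr rfl h2, ← Finset.mul_sum]
    refine mul_ne_zero (Finset.prod_ne_zero_iff.2 fun i _ => pow_ne_zero _ ?_)
      (hc _ fun i => Complex.im_cayley_pos (hx i))
    have h5 : -Complex.I / 2 + Complex.I / 2 * x i = -Complex.I / 2 * (1 - x i) := by ring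
    rw [h5]
    exact mul_ne_zero (by simp) (hne i)
  have hgne : ∀ z : ρ → ℂ, (∀ i, 0 < (z i).im) → ∀ v : σ → ℂ, (∀ i, ‖v i‖ < 1) →
      ∑ β ∈ Finset.Iic κ, (((∏ i, (κ i).choose (β i) : ℕ) : ℂ) * ∏ i, v i ^ β i) *
        eval z (L (e β)) ≠ 0 := by
    intro z hz v hv
    have hne : ∀ i, 1 + v i ≠ 0 := by
      intro i h
      have := hv i
      rw [eq_neg_of_add_eq_zero_right h] at this
      simp at this
    set W : σ → ℂ := fun i => Complex.I * (1 + -v i) / (1 - -v i) with hW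
    have hWpos : ∀ i, 0 < (W i).im := fun i => Complex.im_cayley_pos (by simpa using hv i)
    have h1 : ∏ i, (C (v i) * (X i - C Complex.I) + (X i + C Complex.I)) ^ κ i =
        (∏ i, (1 + v i) ^ κ i) • ∏ i, (X i + C (W i) : MvPolynomial σ ℂ) ^ κ i := by
      rw [smul_eq_C_mul, map_prod, ← Finset.prod_mul_distrib]
      refine Finset.prod_congr rfl fun i _ => ?_
      rw [C_pow, ← mul_pow]
      congr 1
      have h2 : (C (1 + v i) * C (W i) : MvPolynomial σ ℂ) =
          C Complex.I - C (v i) * C Complex.I := by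
        rw [← C_mul, ← C_mul, ← C_sub]
        congr 1
        rw [hW]
        simp only [sub_neg_eq_add]
        rw [mul_div_assoc', div_eq_iff (hne i)]
        ring
      rw [mul_add, h2, C_add, C_1]
      ring
    have h2 := congrArg (fun F => eval z (L F)) h1
    simp only [map_smul, smul_eval] at h2
    rw [prod_add_pow_eq_sum_Iic κ (fun i => C (v i) * (X i - C Complex.I))
      (fun i => X i + C Complex.I), prod_add_pow_eq_sum_Iic κ X (fun i => C (W i)),
      map_sum, map_sum, map_sum, map_sum] at h2
    have h3 : ∀ β ∈ Finset.Iic κ, eval z (L (((∏ i, (κ i).choose (β i) : ℕ) : MvPolynomial σ ℂ) *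
        ∏ i, ((C (v i) * (X i - C Complex.I)) ^ β i * (X i + C Complex.I) ^ (κ i - β i)))) =
        (((∏ i, (κ i).choose (β i) : ℕ) : ℂ) * ∏ i, v i ^ β i) * eval z (L (e β)) := by
      intro β _
      have : ((∏ i, (κ i).choose (β i) : ℕ) : MvPolynomial σ ℂ) *
        ∏ i, ((C (v i) * (X i - C Complex.I)) ^ β i * (X i + C Complex.I) ^ (κ i - β i)) =
        (((∏ i, (κ i).choose (β i) : ℕ) : ℂ) * ∏ i, v i ^ β i) • e β := by
        rw [smul_eq_C_mul, C_mul, map_natCast, mul_assoc, map_prod, he,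
          ← Finset.prod_mul_distrib]
        congr 1
        refine Finset.prod_congr rfl fun i _ => ?_
        rw [C_pow, mul_pow]
        ring
      rw [this, map_smul, smul_eval]
    have h4 : ∀ β ∈ Finset.Iic κ, eval z (L (((∏ i, (κ i).choose (β i) : ℕ) : MvPolynomial σ ℂ) *
        ∏ i, (X i ^ β i * C (W i) ^ (κ i - β i)))) =
        ((∏ i, (κ i).choose (β i) : ℕ) : ℂ) * (∏ i, W i ^ (κ i - β i)) * eval z (t β) := by
      intro β _
      have : ((∏ i, (κ i).choose (β i) : ℕ) : MvPolynomial σ ℂ) *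
        ∏ i, (X i ^ β i * C (W i) ^ (κ i - β i)) =
        (((∏ i, (κ i).choose (β i) : ℕ) : ℂ) * ∏ i, W i ^ (κ i - β i)) • ∏ i, X i ^ β i := by
        rw [smul_eq_C_mul, C_mul, map_natCast, mul_assoc, map_prod, ← Finset.prod_mul_distrib]
        congr 1
        refine Finset.prod_congr rfl fun i _ => ?_
        rw [C_pow]
        ring
      rw [this, map_smul, smul_eval, hLmon]
    rw [Finset.sum_congr rfl h3, Finset.sum_congr rfl h4] at h2
    rw [h2]
    exact mul_ne_zero (Finset.prod_ne_zero_iff.2 fun i _ => pow_ne_zero _ (hne i))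
      (hsymb z W hz hWpos)
  have hmain : ∑ β ∈ Finset.Iic κ, c β • t β = ∑ α ∈ Finset.Iic κ, f α • L (e α) := by
    have := congrArg L hcayley
    simp only [map_sum, map_smul, hLmon] at this
    exact this.symm
  rw [hmain]
  refine isStable_or_eq_zero_of_tendsto (l := nhdsWithin (1 : ℝ) (Set.Iio 1))
    (f := fun r : ℝ => ∑ α ∈ Finset.Iic κ, (f α * ∏ i, ((r : ℂ) ^ α i) ^ 2) • L (e α))
    (N := (Finset.Iic κ).sup fun α => (L (e α)).totalDegree) ?_ ?_ ?_
  · refine Filter.Eventually.of_forall fun r => (totalDegree_finsetSum _ _).trans ?_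
    exact Finset.sup_mono_fun fun α _ => totalDegree_smul_le _ _
  · filter_upwards [Ioo_mem_nhdsLT (zero_lt_one' ℝ)] with r hr z hz
    have hrx : ∀ x : ℂ, ‖x‖ ≤ 1 → ‖(r : ℂ) * x‖ < 1 := by
      intro x hx
      rw [norm_mul, Complex.norm_real, Real.norm_of_nonneg hr.1.le]
      nlinarith [hr.1, hr.2, norm_nonneg x]
    have key := sum_prod_ite_div_choose_ne_zero (J := Finset.Iic κ ×ˢ Finset.Iic κ)
      (x := fun j : (σ →₀ ℕ) × (σ →₀ ℕ) => (f j.1 * ∏ i, (r : ℂ) ^ j.1 i) *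
        (((∏ i, (κ i).choose (j.2 i) : ℕ) : ℂ) * (∏ i, (r : ℂ) ^ j.2 i) * eval z (L (e j.2))))
      (p := fun j => j.1) (q := fun j => j.2) (κ := κ)
      (fun j hj => Finset.mem_Iic.1 (Finset.mem_product.1 hj).1)
      (fun j hj => Finset.mem_Iic.1 (Finset.mem_product.1 hj).2)
      (fun u w hu hw => by
        convert mul_ne_zero (hfne (fun i => r * u i) fun i => hrx _ (hu i))
          (hgne z hz (fun i => r * w i) fun i => hrx _ (hw i)) using 1
        rw [Finset.sum_mul_sum, Finset.sum_product]
        refine Finset.sum_congr rfl fun α _ => Finset.sum_congr rfl fun β _ => ?_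
        simp only [mul_pow, Finset.prod_mul_distrib]
        ring)
    convert key using 1
    rw [Finset.sum_product, map_sum]
    refine Finset.sum_congr rfl fun α hα => ?_
    rw [Finset.sum_eq_single α]
    · have hne : ((∏ i, (κ i).choose (α i) : ℕ) : ℂ) ≠ 0 := by
        exact_mod_cast Finset.prod_ne_zero_iff.2 fun i _ =>
          (Nat.choose_pos (Finset.mem_Iic.1 hα i)).ne'
      have h1 : ∏ i, (if α i = α i then 1 / ((κ i).choose (α i) : ℂ) else 0) =
          1 / ((∏ i, (κ i).choose (α i) : ℕ) : ℂ) := by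
        simp
      rw [h1, smul_eval, Finset.prod_pow]
      field_simp
    · intro β _ hβ
      obtain ⟨i, hi⟩ : ∃ i, α i ≠ β i := by
        by_contra! h
        exact hβ (Finsupp.ext fun i => (h i).symm)
      have h0 : ∏ i, (if α i = β i then 1 / ((κ i).choose (α i) : ℂ) else 0) = 0 :=
        Finset.prod_eq_zero (Finset.mem_univ i) (if_neg hi)
      rw [h0, mul_zero]
    · exact fun h => absurd hα h
  · intro z _
    refine tendsto_nhdsWithin_of_tendsto_nhds ?_
    have : Continuous fun r : ℝ => eval z
        (∑ α ∈ Finset.Iic κ, (f α * ∏ i, ((r : ℂ) ^ α i) ^ 2) • L (e α)) := by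
      simp only [map_sum, smul_eval]
      fun_prop
    simpa using this.tendsto 1

lemma MvPolynomial.aeval_monomial_one {σ : Type*} [Fintype σ] (β : σ →₀ ℕ) (z : σ → ℂ) :
    aeval z (monomial β 1 : MvPolynomial σ ℝ) = ∏ i, z i ^ β i := by
  simp [monomial_one_eq_prod]

lemma aeval_algSymbolSigned {n : ℕ} (ε : ℝ) (κ : Fin n →₀ ℕ)
    (T : MvPolynomial (Fin n) ℝ →ₗ[ℝ] MvPolynomial (Fin n) ℝ) (z w : Fin n → ℂ) :
    aeval (Sum.elim z w) (algSymbolSigned ε κ T) =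
      ∑ β ∈ Finset.Iic κ, ((∏ i, (κ i).choose (β i) : ℕ) : ℂ) *
        (∏ i, ((ε : ℂ) * w i) ^ (κ i - β i)) * aeval z (T (monomial β 1)) := by
  rw [algSymbolSigned, map_sum]
  refine Finset.sum_congr rfl fun β _ => ?_
  have h1 : (Sum.elim z w ∘ Sum.inl : Fin n → ℂ) = z := by ext; simp
  have h2 : (monomial (Finsupp.mapDomain Sum.inr (κ - β)) 1 :
      MvPolynomial (Fin n ⊕ Fin n) ℝ) = rename Sum.inr (monomial (κ - β) 1) := by
    rw [rename_monomial]
  have h3 : (Sum.elim z w ∘ Sum.inr : Fin n → ℂ) = w := by ext; simp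
  simp only [map_mul]
  rw [aeval_rename, h1, h2, aeval_rename, h3, aeval_monomial_one,
    Finsupp.sum_fintype _ _ (fun _ => rfl), ← Finset.prod_pow_eq_pow_sum]
  simp only [mul_pow, Finset.prod_mul_distrib, map_prod, map_pow, aeval_C,
    Complex.coe_algebraMap, Finsupp.tsub_apply, Complex.ofReal_natCast]
  push_cast
  ring

lemma isRealStable_algSymbolSigned_iff {n : ℕ} {ε : ℝ} {κ : Fin n →₀ ℕ}
    {T : MvPolynomial (Fin n) ℝ →ₗ[ℝ] MvPolynomial (Fin n) ℝ} :
    IsRealStable (algSymbolSigned ε κ T) ↔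
      ∀ z w : Fin n → ℂ, (∀ i, 0 < (z i).im) → (∀ i, 0 < (w i).im) →
        ∑ β ∈ Finset.Iic κ, ((∏ i, (κ i).choose (β i) : ℕ) : ℂ) *
          (∏ i, ((ε : ℂ) * w i) ^ (κ i - β i)) * aeval z (T (monomial β 1)) ≠ 0 := by
  constructor
  · intro h z w hz hw
    rw [← aeval_algSymbolSigned]
    exact h _ (Sum.rec hz hw)
  · intro h z hz
    rw [← Sum.elim_comp_inl_inr z, aeval_algSymbolSigned]
    exact h _ _ (fun i => hz (Sum.inl i)) fun i => hz (Sum.inr i)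

lemma MvPolynomial.eq_sum_Iic_of_degreeOf_le {σ A : Type*} [Fintype σ] [DecidableEq σ]
    [CommSemiring A] {κ : σ →₀ ℕ} {f : MvPolynomial σ A} (hf : ∀ i, f.degreeOf i ≤ κ i) :
    f = ∑ β ∈ Finset.Iic κ, coeff β f • monomial β 1 := by
  conv_lhs => rw [f.as_sum]
  simp only [smul_monomial, smul_eq_mul, mul_one]
  refine Finset.sum_subset (fun β hβ => Finset.mem_Iic.2 fun i => ?_) fun β _ hβ => ?_
  · exact (monomial_le_degreeOf i hβ).trans (hf i)
  · rw [notMem_support_iff.1 hβ, map_zero]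

lemma MvPolynomial.degreeOf_sum_Iic_le {σ A : Type*} [Fintype σ] [DecidableEq σ]
    [CommSemiring A] {κ : σ →₀ ℕ} (c : (σ →₀ ℕ) → A) (i : σ) :
    (∑ β ∈ Finset.Iic κ, c β • (monomial β 1 : MvPolynomial σ A)).degreeOf i ≤ κ i := by
  refine (degreeOf_sum_le _ _ _).trans (Finset.sup_le fun β hβ => ?_)
  rw [degreeOf_le_iff]
  intro m hm
  rw [smul_monomial] at hm
  rw [Finset.mem_singleton.1 (support_monomial_subset hm)]
  exact Finset.mem_Iic.1 hβ i

lemma MvPolynomial.aeval_sum_smul {σ ι : Type*} (s : Finset ι) (c : ι → ℝ)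
    (t : ι → MvPolynomial σ ℝ) (z : σ → ℂ) :
    aeval z (∑ β ∈ s, c β • t β) = ∑ β ∈ s, (c β : ℂ) * aeval z (t β) := by
  simp [map_sum, map_smul]

lemma isRealStable_sum_smul_of_symbol {n : ℕ} {κ : Fin n →₀ ℕ}
    {t : (Fin n →₀ ℕ) → MvPolynomial (Fin n) ℝ} {c : (Fin n →₀ ℕ) → ℝ}
    (hsymb : ∀ z w : Fin n → ℂ, (∀ i, 0 < (z i).im) → (∀ i, 0 < (w i).im) →
      ∑ β ∈ Finset.Iic κ, ((∏ i, (κ i).choose (β i) : ℕ) : ℂ) * (∏ i, w i ^ (κ i - β i)) *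
        aeval z (t β) ≠ 0)
    (hc : ∀ u : Fin n → ℂ, (∀ i, 0 < (u i).im) →
      ∑ β ∈ Finset.Iic κ, (c β : ℂ) * ∏ i, u i ^ β i ≠ 0) :
    IsRealStable (∑ β ∈ Finset.Iic κ, c β • t β) ∨ ∑ β ∈ Finset.Iic κ, c β • t β = 0 := by
  have hmap : ∑ β ∈ Finset.Iic κ, (c β : ℂ) • map (algebraMap ℝ ℂ) (t β) =
      map (algebraMap ℝ ℂ) (∑ β ∈ Finset.Iic κ, c β • t β) := by
    simp [map_sum, smul_eq_C_mul]
  have key := isStable_sum_smul_of_symbol (κ := κ) (c := fun β => (c β : ℂ))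
    (t := fun β => map (algebraMap ℝ ℂ) (t β))
    (by simpa only [eval_map_algebraMap_complex] using hsymb) hc
  rw [hmap] at key
  refine key.imp (fun h z hz => ?_) fun h => ?_
  · rw [← eval_map_algebraMap_complex]
    exact h z hz
  · exact map_injective _ (algebraMap ℝ ℂ).injective (h.trans (map_zero _).symm)

lemma isRealStable_apply_of_symbol {n : ℕ} {κ : Fin n →₀ ℕ}
    {T : MvPolynomial (Fin n) ℝ →ₗ[ℝ] MvPolynomial (Fin n) ℝ}
    (hT : IsRealStable (algSymbolSigned 1 κ T)) {f : MvPolynomial (Fin n) ℝ}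
    (hdeg : ∀ i, f.degreeOf i ≤ κ i) (hf : IsRealStable f) : IsRealStable (T f) ∨ T f = 0 := by
  rw [isRealStable_algSymbolSigned_iff] at hT
  have hTf := congrArg T (eq_sum_Iic_of_degreeOf_le hdeg)
  simp only [map_sum, map_smul] at hTf
  rw [hTf]
  refine isRealStable_sum_smul_of_symbol (by simpa using hT) fun u hu => ?_
  have := hf u hu
  rw [eq_sum_Iic_of_degreeOf_le hdeg, aeval_sum_smul] at this
  simpa only [aeval_monomial_one] using this

lemma isRealStable_apply_of_symbol_neg {n : ℕ} {κ : Fin n →₀ ℕ}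
    {T : MvPolynomial (Fin n) ℝ →ₗ[ℝ] MvPolynomial (Fin n) ℝ}
    (hT : IsRealStable (algSymbolSigned (-1) κ T)) {f : MvPolynomial (Fin n) ℝ}
    (hdeg : ∀ i, f.degreeOf i ≤ κ i) (hf : IsRealStable f) : IsRealStable (T f) ∨ T f = 0 := by
  rw [isRealStable_algSymbolSigned_iff] at hT
  have hTf := congrArg T (eq_sum_Iic_of_degreeOf_le hdeg)
  simp only [map_sum, map_smul] at hTf
  set s : (Fin n →₀ ℕ) → ℝ := fun β => ∏ i, (-1) ^ (κ i - β i) with hs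
  have hss : ∀ β, s β * s β = 1 := by
    intro β
    rw [hs, ← Finset.prod_mul_distrib]
    simp [← mul_pow]
  have hsum : T f = ∑ β ∈ Finset.Iic κ, (s β * coeff β f) • s β • T (monomial β 1) := by
    rw [hTf]
    refine Finset.sum_congr rfl fun β _ => ?_
    rw [smul_smul, mul_right_comm, hss, one_mul]
  rw [hsum]
  refine isRealStable_sum_smul_of_symbol (fun z w hz hw => ?_) fun u hu => ?_
  · convert hT z w hz hw using 2 with β
    simp only [map_smul, hs, mul_pow, Finset.prod_mul_distrib, Complex.real_smul]
    push_cast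
    ring
  · have hconj : aeval (fun i => -u i) f ≠ 0 := by
      have h := hf (fun i => -(starRingEnd ℂ) (u i)) (fun i => by simpa using hu i)
      have h' := aeval_conj f fun i => -(starRingEnd ℂ) (u i)
      simp only [map_neg, Complex.conj_conj] at h'
      rw [h']
      exact (map_ne_zero _).2 h
    rw [eq_sum_Iic_of_degreeOf_le hdeg, aeval_sum_smul] at hconj
    have hs' : ∀ β ∈ Finset.Iic κ, ((s β * coeff β f : ℝ) : ℂ) * ∏ i, u i ^ β i =
        (∏ i, (-1) ^ κ i) * (((coeff β f : ℝ) : ℂ) * aeval (fun i => -u i)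
          (monomial β 1 : MvPolynomial (Fin n) ℝ)) := by
      intro β hβ
      rw [aeval_monomial_one]
      have h1 : ∀ i, κ i = β i + (κ i - β i) :=
        fun i => (Nat.add_sub_cancel' (Finset.mem_Iic.1 hβ i)).symm
      have h2 : ∏ i, (-1 : ℂ) ^ κ i = (∏ i, (-1) ^ β i) * ∏ i, (-1) ^ (κ i - β i) := by
        rw [← Finset.prod_mul_distrib]
        exact Finset.prod_congr rfl fun i _ => by rw [← pow_add, ← h1]
      have h3 : ∏ i, (-u i) ^ β i = (∏ i, (-1) ^ β i) * ∏ i, u i ^ β i := by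
        rw [← Finset.prod_mul_distrib]
        exact Finset.prod_congr rfl fun i _ => by rw [← mul_pow, neg_one_mul]
      have h4 : (∏ i, (-1 : ℂ) ^ β i) * ∏ i, (-1 : ℂ) ^ β i = 1 := by
        rw [← Finset.prod_mul_distrib]
        simp [← mul_pow]
      rw [h2, h3, hs]
      push_cast
      linear_combination (-(∏ i, (-1 : ℂ) ^ (κ i - β i)) * ((coeff β f : ℝ) : ℂ) *
        ∏ i, u i ^ β i) * h4
    rw [Finset.sum_congr rfl hs', ← Finset.mul_sum]
    exact mul_ne_zero (Finset.prod_ne_zero_iff.2 fun i _ => pow_ne_zero _ (by norm_num)) hconj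

lemma isRealStable_smul_add_smul {σ : Type*} [Finite σ] {P Q : MvPolynomial σ ℝ}
    (hPQ : ProperPosition P Q) (a b : ℝ) :
    IsRealStable (a • P + b • Q) ∨ a • P + b • Q = 0 := by
  by_cases hab : (b : ℂ) - Complex.I * a = 0
  · right
    have hb := congrArg Complex.re hab
    have ha := congrArg Complex.im hab
    simp at ha hb
    simp [ha, hb]
  · refine isRealStable_or_eq_zero_of_forall_ne_zero (g := b • P - a • Q) fun z hz => ?_
    have h := hPQ z hz
    simp only [map_add, smul_eval, eval_map_algebraMap_complex] at h
    convert mul_ne_zero hab h using 1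
    simp only [map_add, map_sub, map_smul, Complex.real_smul]
    linear_combination ((a : ℂ) * aeval z P) * Complex.I_mul_I

lemma IsPreconnected.forall_pos_or_forall_neg {X : Type*} [TopologicalSpace X] {s : Set X}
    (hs : IsPreconnected s) {φ : X → ℝ} (hφ : ContinuousOn φ s) (hne : ∀ x ∈ s, φ x ≠ 0) :
    (∀ x ∈ s, 0 < φ x) ∨ ∀ x ∈ s, φ x < 0 := by
  by_contra! hcon
  obtain ⟨⟨a, ha, ha0⟩, b, hb, hb0⟩ := hcon
  obtain ⟨x, hx, hx0⟩ := hs.intermediate_value ha hb hφ ⟨ha0, hb0⟩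
  exact hne x hx hx0

lemma isPreconnected_setOf_forall_im_pos (σ : Type*) :
    IsPreconnected {z : σ → ℂ | ∀ i, 0 < (z i).im} := by
  have : {z : σ → ℂ | ∀ i, 0 < (z i).im} = Set.univ.pi fun _ => {z : ℂ | 0 < z.im} := by
    ext; simp
  rw [this]
  exact (convex_pi fun _ _ => convex_halfSpace_im_gt 0).isPreconnected

lemma MvPolynomial.continuous_aeval_complex {σ : Type*} (p : MvPolynomial σ ℝ) :
    Continuous fun z : σ → ℂ => aeval z p := by
  simp_rw [← eval_map_algebraMap_complex]
  exact continuous_eval _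

lemma Complex.exists_eq_real_mul_of_im_mul_conj_eq_zero {x y : ℂ} (hy : y ≠ 0)
    (h : (x * (starRingEnd ℂ) y).im = 0) : ∃ r : ℝ, x = r * y := by
  have h' : (x / y).im = 0 := by
    rw [← mul_div_mul_right x y ((map_ne_zero (starRingEnd ℂ)).2 hy), Complex.mul_conj,
      Complex.div_ofReal_im, h, zero_div]
  refine ⟨(x / y).re, ?_⟩
  rw [← div_eq_iff hy]
  exact Complex.ext (by simp) (by simp [h'])

lemma Complex.add_I_mul_ne_zero_of_im_mul_conj_pos {x y : ℂ}
    (h : 0 < (x * (starRingEnd ℂ) y).im) : x + I * y ≠ 0 := by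
  intro h0
  rw [eq_neg_of_add_eq_zero_left h0, neg_mul, mul_assoc, Complex.mul_conj] at h
  simp at h
  exact absurd h (Complex.normSq_nonneg y).not_gt

lemma isRealStable_of_smul {σ : Type*} {r : ℝ} {p : MvPolynomial σ ℝ}
    (h : IsRealStable (r • p)) : IsRealStable p := by
  intro z hz h0
  exact h z hz (by rw [map_smul, h0, smul_zero])

lemma eq_zero_of_aeval_eq_zero {σ : Type*} {p : MvPolynomial σ ℝ}
    (h : IsRealStable p ∨ p = 0) {z : σ → ℂ} (hz : ∀ i, 0 < (z i).im) (h0 : aeval z p = 0) :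
    p = 0 :=
  h.resolve_left fun hp => hp z hz h0

lemma eq_smul_add_smul_of_im_pos {V σ : Type*} [AddCommGroup V] [Module ℝ V]
    {T : V →ₗ[ℝ] MvPolynomial σ ℝ} (hT : ∀ v, IsRealStable (T v) ∨ T v = 0) {v w : V}
    (hpos : ∀ z : σ → ℂ, (∀ i, 0 < (z i).im) →
      0 < (aeval z (T w) * (starRingEnd ℂ) (aeval z (T v))).im) :
    ∃ (a b : V →ₗ[ℝ] ℝ) (P Q : MvPolynomial σ ℝ), IsRealStable P ∧ IsRealStable Q ∧
      ProperPosition P Q ∧ ∀ u, T u = a u • P + b u • Q := by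
  set p : ℂ := aeval (fun _ => Complex.I) (T v) with hp
  set q : ℂ := aeval (fun _ => Complex.I) (T w) with hq
  have hI : ∀ i : σ, 0 < ((fun _ => Complex.I : σ → ℂ) i).im := fun i => by simp
  have hpq : (q * (starRingEnd ℂ) p).im ≠ 0 := (hpos _ hI).ne'
  set ev : V →ₗ[ℝ] ℂ := (aeval fun _ => Complex.I : MvPolynomial σ ℝ →ₐ[ℝ] ℂ).toLinearMap ∘ₗ T
    with hev
  set L : ℂ → V →ₗ[ℝ] ℝ := fun y => (q * (starRingEnd ℂ) p).im⁻¹ • Complex.imLm ∘ₗ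
    LinearMap.mulRight ℝ ((starRingEnd ℂ) y) ∘ₗ ev with hL
  refine ⟨-L q, L p, T v, T w, ?_, ?_, fun z hz => ?_, fun u => ?_⟩
  · refine (hT v).resolve_right fun h => hpq ?_
    simp [hp, h]
  · refine (hT w).resolve_right fun h => hpq ?_
    simp [hq, h]
  · simp only [map_add, smul_eval, eval_map_algebraMap_complex]
    exact Complex.add_I_mul_ne_zero_of_im_mul_conj_pos (hpos z hz)
  · have h0 : T (u - ((-L q) u • v + (L p) u • w)) = 0 := by
      refine eq_zero_of_aeval_eq_zero (hT _) hI ?_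
      rw [map_sub, map_sub, map_add, map_smul, map_smul, map_add, map_smul, map_smul, ← hp, ← hq]
      set x : ℂ := aeval (fun _ => Complex.I) (T u) with hx
      have hLx : ∀ y, L y u = (q * (starRingEnd ℂ) p).im⁻¹ * (x * (starRingEnd ℂ) y).im := by
        intro y
        simp [hL, hev, hx]
      rw [LinearMap.neg_apply, hLx, hLx, sub_eq_zero]
      refine mul_left_cancel₀ (Complex.ofReal_ne_zero.2 hpq) ?_
      simp only [Complex.real_smul, mul_add, ← mul_assoc, ← Complex.ofReal_mul, mul_neg,
        mul_inv_cancel₀ hpq, one_mul]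
      apply Complex.ext <;> simp <;> ring
    rw [map_sub, sub_eq_zero] at h0
    rw [h0, map_add, map_smul, map_smul]

lemma eq_smul_add_smul_of_forall_isRealStable {V σ : Type*} [AddCommGroup V] [Module ℝ V]
    {T : V →ₗ[ℝ] MvPolynomial σ ℝ} (hT : ∀ v, IsRealStable (T v) ∨ T v = 0) :
    ∃ (a b : V →ₗ[ℝ] ℝ) (P Q : MvPolynomial σ ℝ), IsRealStable P ∧ IsRealStable Q ∧
      ProperPosition P Q ∧ ∀ u, T u = a u • P + b u • Q := by
  have hI : ∀ i : σ, 0 < ((fun _ => Complex.I : σ → ℂ) i).im := fun i => by simp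
  have hself : ∀ {P : MvPolynomial σ ℝ}, IsRealStable P → ProperPosition P P := by
    intro P hP z hz
    simp only [map_add, smul_eval, eval_map_algebraMap_complex]
    rw [← one_add_mul]
    refine mul_ne_zero (fun h => ?_) (hP z hz)
    simpa using congrArg Complex.re h
  have him : ∀ x y : ℂ, (x * (starRingEnd ℂ) y).im = -(y * (starRingEnd ℂ) x).im := by
    intro x y
    simp
    ring
  by_cases h : ∃ v w, (aeval (fun _ => Complex.I) (T w) *
      (starRingEnd ℂ) (aeval (fun _ => Complex.I) (T v))).im ≠ 0
  · obtain ⟨v, w, hvw⟩ := h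
    have hv : IsRealStable (T v) := (hT v).resolve_right fun h => hvw (by simp [h])
    have hne : ∀ z ∈ {z : σ → ℂ | ∀ i, 0 < (z i).im},
        (aeval z (T w) * (starRingEnd ℂ) (aeval z (T v))).im ≠ 0 := by
      intro z hz h0
      obtain ⟨r, hr⟩ := Complex.exists_eq_real_mul_of_im_mul_conj_eq_zero (hv z hz) h0
      have h1 : T (w - r • v) = 0 := by
        refine eq_zero_of_aeval_eq_zero (hT _) hz ?_
        rw [map_sub, map_sub, map_smul, map_smul, hr, Complex.real_smul, sub_self]
      rw [map_sub, sub_eq_zero] at h1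
      rw [h1, map_smul, map_smul, Complex.real_smul, mul_assoc, Complex.mul_conj,
        ← Complex.ofReal_mul] at hvw
      exact hvw (Complex.ofReal_im _)
    have hcont : Continuous fun z : σ → ℂ => (aeval z (T w) * (starRingEnd ℂ) (aeval z (T v))).im :=
      Complex.continuous_im.comp ((continuous_aeval_complex _).mul
        (Complex.continuous_conj.comp (continuous_aeval_complex _)))
    rcases (isPreconnected_setOf_forall_im_pos σ).forall_pos_or_forall_neg hcont.continuousOn hne
      with hs | hs
    · exact eq_smul_add_smul_of_im_pos hT hs
    · refine eq_smul_add_smul_of_im_pos hT (v := w) (w := v) fun z hz => ?_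
      rw [him, neg_pos]
      exact hs z hz
  · push Not at h
    by_cases h0 : ∀ v, T v = 0
    · have h1 : IsRealStable (1 : MvPolynomial σ ℝ) := fun z _ => by simp
      exact ⟨0, 0, 1, 1, h1, h1, hself h1, fun u => by simp [h0]⟩
    · push Not at h0
      obtain ⟨v, hv⟩ := h0
      have hvs := (hT v).resolve_right hv
      set p : ℂ := aeval (fun _ => Complex.I) (T v) with hp
      refine ⟨Complex.reLm ∘ₗ LinearMap.mulRight ℝ p⁻¹ ∘ₗ
        (aeval fun _ => Complex.I : MvPolynomial σ ℝ →ₐ[ℝ] ℂ).toLinearMap ∘ₗ T, 0, T v, T v,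
        hvs, hvs, hself hvs, fun u => ?_⟩
      obtain ⟨r, hr⟩ := Complex.exists_eq_real_mul_of_im_mul_conj_eq_zero (hvs _ hI) (h v u)
      have h1 : T (u - r • v) = 0 := by
        refine eq_zero_of_aeval_eq_zero (hT _) hI ?_
        rw [map_sub, map_sub, map_smul, map_smul, hr, Complex.real_smul, sub_self]
      rw [map_sub, sub_eq_zero, map_smul] at h1
      have hp0 : p ≠ 0 := hvs _ hI
      have h2 : (aeval (fun _ => Complex.I) (T u) * p⁻¹).re = r := by
        rw [hr, mul_assoc, mul_inv_cancel₀ hp0, mul_one, Complex.ofReal_re]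
      rw [LinearMap.zero_apply, zero_smul, add_zero, h1]
      exact congrArg (· • T v) h2.symm

lemma MvPolynomial.aeval_re_add_I_mul_im {σ ι : Type*} (s : Finset ι) (γ : ι → ℂ)
    (t : ι → MvPolynomial σ ℝ) (z : σ → ℂ) :
    aeval z (∑ β ∈ s, (γ β).re • t β) + Complex.I * aeval z (∑ β ∈ s, (γ β).im • t β) =
      ∑ β ∈ s, γ β * aeval z (t β) := by
  rw [aeval_sum_smul, aeval_sum_smul, Finset.mul_sum, ← Finset.sum_add_distrib]
  refine Finset.sum_congr rfl fun β _ => ?_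
  linear_combination aeval z (t β) * Complex.re_add_im (γ β)

lemma Complex.norm_pow_le_mul_norm_add_pow {w : ℂ} (hw : 0 < w.im) {b k : ℕ} (hbk : b ≤ k) :
    ∃ K : ℝ, ∀ u : ℂ, 0 < u.im → ‖u ^ b‖ ≤ K * ‖(u + w) ^ k‖ := by
  refine ⟨(1 + ‖w‖ / w.im) ^ b * (1 / w.im) ^ (k - b), fun u hu => ?_⟩
  have h1 : w.im ≤ ‖u + w‖ := by
    refine le_trans ?_ (Complex.im_le_norm _)
    simp [hu.le]
  have h2 : 1 ≤ 1 / w.im * ‖u + w‖ := by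
    rw [one_div_mul_eq_div, le_div_iff₀ hw, one_mul]
    exact h1
  have h3 : ‖u‖ ≤ (1 + ‖w‖ / w.im) * ‖u + w‖ := by
    have h4 : ‖u‖ ≤ ‖u + w‖ + ‖w‖ := by simpa using norm_sub_le (u + w) w
    have h5 : ‖w‖ ≤ ‖w‖ / w.im * ‖u + w‖ := by
      have := mul_le_mul_of_nonneg_left h2 (norm_nonneg w)
      calc ‖w‖ = ‖w‖ * 1 := (mul_one _).symm
        _ ≤ _ := this
        _ = _ := by ring
    linarith
  calc ‖u ^ b‖ = ‖u‖ ^ b := norm_pow _ _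
    _ ≤ ((1 + ‖w‖ / w.im) * ‖u + w‖) ^ b := by gcongr
    _ ≤ ((1 + ‖w‖ / w.im) * ‖u + w‖) ^ b * (1 / w.im * ‖u + w‖) ^ (k - b) :=
        le_mul_of_one_le_right (by positivity) (one_le_pow₀ h2)
    _ = _ := by
        rw [mul_pow, mul_pow, norm_pow]
        rw [← pow_mul_pow_sub ‖u + w‖ hbk]
        ring

lemma exists_norm_aeval_le_mul_prod {σ : Type*} [Fintype σ] [DecidableEq σ] {κ : σ →₀ ℕ}
    {W : σ → ℂ} (hW : ∀ i, 0 < (W i).im) {p : MvPolynomial σ ℝ} (hp : ∀ i, p.degreeOf i ≤ κ i) :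
    ∃ M : ℝ, ∀ u : σ → ℂ, (∀ i, 0 < (u i).im) →
      ‖aeval u p‖ ≤ M * ‖∏ i, (u i + W i) ^ κ i‖ := by
  have hK : ∀ β : σ →₀ ℕ, ∃ K : ℝ, β ≤ κ → ∀ u : σ → ℂ, (∀ i, 0 < (u i).im) →
      ‖∏ i, u i ^ β i‖ ≤ K * ‖∏ i, (u i + W i) ^ κ i‖ := by
    intro β
    by_cases hβ : β ≤ κ
    · choose K hK using fun i => Complex.norm_pow_le_mul_norm_add_pow (hW i) (hβ i)
      refine ⟨∏ i, K i, fun _ u hu => ?_⟩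
      rw [norm_prod, norm_prod, ← Finset.prod_mul_distrib]
      exact Finset.prod_le_prod (fun _ _ => norm_nonneg _) fun i _ => hK i _ (hu i)
    · exact ⟨0, fun h => absurd h hβ⟩
  choose K hK using hK
  refine ⟨∑ β ∈ Finset.Iic κ, ‖coeff β p‖ * K β, fun u hu => ?_⟩
  rw [eq_sum_Iic_of_degreeOf_le hp, aeval_sum_smul, ← eq_sum_Iic_of_degreeOf_le hp,
    Finset.sum_mul]
  refine norm_sum_le_of_le _ fun β hβ => ?_
  rw [norm_mul, Complex.norm_real, aeval_monomial_one, mul_assoc]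
  exact mul_le_mul_of_nonneg_left (hK β (Finset.mem_Iic.1 hβ) u hu) (norm_nonneg _)

/-- The coefficients of `(z + W)^κ` as a polynomial in `z`. -/
noncomputable def addPowCoeff {σ : Type*} [Fintype σ] (κ : σ →₀ ℕ) (W : σ → ℂ) (β : σ →₀ ℕ) : ℂ :=
  ((∏ i, (κ i).choose (β i) : ℕ) : ℂ) * ∏ i, W i ^ (κ i - β i)

lemma aeval_re_addPowCoeff {σ : Type*} [Fintype σ] [DecidableEq σ] (κ : σ →₀ ℕ) (c : ℂ)
    (W u : σ → ℂ) :
    aeval u (∑ β ∈ Finset.Iic κ, (c * addPowCoeff κ W β).re • monomial β (1 : ℝ)) +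
      Complex.I * aeval u
        (∑ β ∈ Finset.Iic κ, (c * addPowCoeff κ W β).im • monomial β (1 : ℝ)) =
      c * ∏ i, (u i + W i) ^ κ i := by
  rw [aeval_re_add_I_mul_im, prod_add_pow_eq_sum_Iic, Finset.mul_sum]
  refine Finset.sum_congr rfl fun β _ => ?_
  rw [aeval_monomial_one, addPowCoeff, Finset.prod_mul_distrib]
  ring

lemma prod_add_pow_ne_zero {σ : Type*} [Fintype σ] {κ : σ →₀ ℕ} {W u : σ → ℂ}
    (hW : ∀ i, 0 < (W i).im) (hu : ∀ i, 0 < (u i).im) : ∏ i, (u i + W i) ^ κ i ≠ 0 :=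
  Finset.prod_ne_zero_iff.2 fun i _ => pow_ne_zero _ fun h => by
    have := congrArg Complex.im h
    simp only [Complex.add_im, Complex.zero_im] at this
    linarith [hW i, hu i]

section Necessity

variable {n : ℕ} {κ : Fin n →₀ ℕ} {T : MvPolynomial (Fin n) ℝ →ₗ[ℝ] MvPolynomial (Fin n) ℝ}

lemma isRealStable_apply_of_apply_re_eq_zero
    (hT : ∀ f : MvPolynomial (Fin n) ℝ, (∀ i, f.degreeOf i ≤ κ i) → IsRealStable f →
      IsRealStable (T f) ∨ T f = 0) {c : ℂ} (hc : c ≠ 0) {W : Fin n → ℂ}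
    (hW : ∀ i, 0 < (W i).im)
    (h0 : T (∑ β ∈ Finset.Iic κ, (c * addPowCoeff κ W β).re • monomial β 1) = 0)
    {p : MvPolynomial (Fin n) ℝ} (hp : ∀ i, p.degreeOf i ≤ κ i) :
    IsRealStable (T p) ∨ T p = 0 := by
  obtain ⟨M, hM⟩ := exists_norm_aeval_le_mul_prod hW hp
  set ε : ℝ := ‖c‖ / (|M| + 1) with hε
  have hc' : 0 < ‖c‖ := norm_pos_iff.2 hc
  have hM' : 0 < |M| + 1 := by positivity
  have hε0 : 0 < ε := div_pos hc' hM'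
  set f := ∑ β ∈ Finset.Iic κ, (c * addPowCoeff κ W β).re • monomial β (1 : ℝ) with hf
  have hTf : T (f + ε • p) = ε • T p := by rw [map_add, map_smul, h0, zero_add]
  have hdeg : ∀ i, (f + ε • p).degreeOf i ≤ κ i := fun i =>
    (degreeOf_add_le _ _ _).trans (max_le (degreeOf_sum_Iic_le _ i)
      ((degreeOf_le_iff.2 fun m hm => degreeOf_le_iff.1 (hp i) m (support_smul hm))))
  have hstab : IsRealStable (f + ε • p) ∨ f + ε • p = 0 := by
    refine isRealStable_or_eq_zero_of_forall_ne_zero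
      (g := ∑ β ∈ Finset.Iic κ, (c * addPowCoeff κ W β).im • monomial β 1) fun u hu h => ?_
    rw [map_add, add_right_comm, aeval_re_addPowCoeff, map_smul, Complex.real_smul] at h
    have hlt : ‖(ε : ℂ) * aeval u p‖ < ‖c * ∏ i, (u i + W i) ^ κ i‖ := by
      have hP : 0 < ‖∏ i, (u i + W i) ^ κ i‖ := norm_pos_iff.2 (prod_add_pow_ne_zero hW hu)
      rw [norm_mul, norm_mul, Complex.norm_real, Real.norm_of_nonneg hε0.le]
      calc ε * ‖aeval u p‖ ≤ ε * (M * ‖∏ i, (u i + W i) ^ κ i‖) := by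
            gcongr
            exact hM u hu
        _ = ε * M * ‖∏ i, (u i + W i) ^ κ i‖ := by ring
        _ < ‖c‖ * ‖∏ i, (u i + W i) ^ κ i‖ := by
            refine mul_lt_mul_of_pos_right ?_ hP
            rw [hε, div_mul_eq_mul_div, div_lt_iff₀ hM']
            exact mul_lt_mul_of_pos_left ((le_abs_self M).trans_lt (lt_add_one _)) hc'
    rw [eq_neg_of_add_eq_zero_right h, norm_neg] at hlt
    exact lt_irrefl _ hlt
  rcases hstab with hs | hs
  · rcases hT _ hdeg hs with h | h
    · left
      rw [hTf] at h
      exact isRealStable_of_smul h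
    · right
      rw [hTf] at h
      exact (smul_eq_zero.1 h).resolve_left hε0.ne'
  · right
    rw [hs, map_zero] at hTf
    exact (smul_eq_zero.1 hTf.symm).resolve_left hε0.ne'

lemma isRealStable_apply_re
    (hT : ∀ f : MvPolynomial (Fin n) ℝ, (∀ i, f.degreeOf i ≤ κ i) → IsRealStable f →
      IsRealStable (T f) ∨ T f = 0) {c : ℂ} (hc : c ≠ 0) {W : Fin n → ℂ}
    (hW : ∀ i, 0 < (W i).im)
    (h0 : T (∑ β ∈ Finset.Iic κ, (c * addPowCoeff κ W β).re • monomial β 1) ≠ 0) :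
    IsRealStable (T (∑ β ∈ Finset.Iic κ, (c * addPowCoeff κ W β).re • monomial β 1)) := by
  refine (hT _ (degreeOf_sum_Iic_le _) ?_).resolve_right h0
  refine (isRealStable_or_eq_zero_of_forall_ne_zero
    (g := ∑ β ∈ Finset.Iic κ, (c * addPowCoeff κ W β).im • monomial β 1)
    fun u hu => ?_).resolve_right fun h => h0 (by rw [h, map_zero])
  rw [aeval_re_addPowCoeff]
  exact mul_ne_zero hc (prod_add_pow_ne_zero hW hu)

lemma isRealStable_algSymbolSigned_of_forall_apply_re_ne_zero
    (hT : ∀ f : MvPolynomial (Fin n) ℝ, (∀ i, f.degreeOf i ≤ κ i) → IsRealStable f →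
      IsRealStable (T f) ∨ T f = 0)
    (h0 : ∀ c : ℂ, c ≠ 0 → ∀ W : Fin n → ℂ, (∀ i, 0 < (W i).im) →
      T (∑ β ∈ Finset.Iic κ, (c * addPowCoeff κ W β).re • monomial β 1) ≠ 0) :
    IsRealStable (algSymbolSigned 1 κ T) ∨ IsRealStable (algSymbolSigned (-1) κ T) := by
  set A : (Fin n → ℂ) → (Fin n → ℂ) → ℂ := fun z W =>
    ∑ β ∈ Finset.Iic κ, ((addPowCoeff κ W β).re : ℂ) * aeval z (T (monomial β 1)) with hA
  set B : (Fin n → ℂ) → (Fin n → ℂ) → ℂ := fun z W =>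
    ∑ β ∈ Finset.Iic κ, ((addPowCoeff κ W β).im : ℂ) * aeval z (T (monomial β 1)) with hB
  have hcomb : ∀ (a b : ℝ), (a + b * Complex.I : ℂ) ≠ 0 → ∀ z W : Fin n → ℂ,
      (∀ i, 0 < (z i).im) → (∀ i, 0 < (W i).im) → a * A z W - b * B z W ≠ 0 := by
    intro a b hab z W hz hW
    convert isRealStable_apply_re hT hab hW (h0 _ hab W hW) z hz using 1
    simp only [map_sum, map_smul, hA, hB, Finset.mul_sum, ← Finset.sum_sub_distrib]
    refine Finset.sum_congr rfl fun β _ => ?_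
    simp
    ring
  have hne : ∀ x ∈ {z : Fin n → ℂ | ∀ i, 0 < (z i).im} ×ˢ {z : Fin n → ℂ | ∀ i, 0 < (z i).im},
      (A x.1 x.2 * (starRingEnd ℂ) (B x.1 x.2)).im ≠ 0 := by
    rintro ⟨z, W⟩ ⟨hz, hW⟩ h
    have hB0 : B z W ≠ 0 := by
      intro hB0
      refine hcomb 0 1 (by simp) z W hz hW ?_
      simp [hB0]
    obtain ⟨r, hr⟩ := Complex.exists_eq_real_mul_of_im_mul_conj_eq_zero hB0 h
    refine hcomb 1 r (fun h => by simpa using congrArg Complex.re h) z W hz hW ?_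
    simp only at hr
    rw [hr]
    simp
  have hcont : Continuous fun x : (Fin n → ℂ) × (Fin n → ℂ) =>
      (A x.1 x.2 * (starRingEnd ℂ) (B x.1 x.2)).im := by
    have h1 : ∀ p : MvPolynomial (Fin n) ℝ,
        Continuous fun x : (Fin n → ℂ) × (Fin n → ℂ) => aeval x.1 p :=
      fun p => (continuous_aeval_complex p).comp continuous_fst
    have h2 : ∀ β, Continuous fun x : (Fin n → ℂ) × (Fin n → ℂ) => addPowCoeff κ x.2 β := by
      intro β
      unfold addPowCoeff
      fun_prop
    refine Complex.continuous_im.comp (Continuous.mul ?_ (Complex.continuous_conj.comp ?_))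
    · exact continuous_finsetSum _ fun β _ =>
        (Complex.continuous_ofReal.comp (Complex.continuous_re.comp (h2 β))).mul (h1 _)
    · exact continuous_finsetSum _ fun β _ =>
        (Complex.continuous_ofReal.comp (Complex.continuous_im.comp (h2 β))).mul (h1 _)
  have hAB : ∀ z W, A z W + Complex.I * B z W =
      ∑ β ∈ Finset.Iic κ, addPowCoeff κ W β * aeval z (T (monomial β 1)) := by
    intro z W
    rw [← aeval_re_add_I_mul_im, aeval_sum_smul, aeval_sum_smul]
  have hAB' : ∀ z W, A z W + Complex.I * -B z W =
      ∑ β ∈ Finset.Iic κ, addPowCoeff κ (fun i => (starRingEnd ℂ) (W i)) β *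
        aeval z (T (monomial β 1)) := by
    intro z W
    have : ∀ β, addPowCoeff κ (fun i => (starRingEnd ℂ) (W i)) β =
        (starRingEnd ℂ) (addPowCoeff κ W β) := by
      intro β
      simp [addPowCoeff]
    rw [← aeval_re_add_I_mul_im, aeval_sum_smul, aeval_sum_smul]
    simp [this, hA, hB]
  rcases ((isPreconnected_setOf_forall_im_pos _).prod
    (isPreconnected_setOf_forall_im_pos _)).forall_pos_or_forall_neg hcont.continuousOn hne
    with hs | hs
  · left
    rw [isRealStable_algSymbolSigned_iff]
    intro z w hz hw
    have := Complex.add_I_mul_ne_zero_of_im_mul_conj_pos (hs (z, w) ⟨hz, hw⟩)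
    rw [hAB] at this
    simpa [addPowCoeff] using this
  · right
    rw [isRealStable_algSymbolSigned_iff]
    intro z w hz hw
    have hs' := hs (z, fun i => -(starRingEnd ℂ) (w i)) ⟨hz, fun i => by simpa using hw i⟩
    rw [← neg_pos, ← Complex.neg_im, ← mul_neg, ← map_neg] at hs'
    have := Complex.add_I_mul_ne_zero_of_im_mul_conj_pos hs'
    rw [hAB'] at this
    simpa [addPowCoeff] using this

end Necessity

/-- Theorem 2 (Borcea–Brändén): a linear operator
`T : ℝ_κ[z₁,…,zₙ] → ℝ[z₁,…,zₙ]` preserves real stability if and only if either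
(a) `T` has range of dimension at most two, being of the form
`T(f) = α(f)·P + β(f)·Q` with `P, Q` real stable and `P ≪ Q`, or
(b) `G_T(z,w)` is real stable in `2n` variables, or
(c) `G_T(z,-w)` is real stable in `2n` variables. -/
theorem real_stability_preserver_finite (n : ℕ) (hn : 1 ≤ n) (κ : Fin n →₀ ℕ)
    (T : MvPolynomial (Fin n) ℝ →ₗ[ℝ] MvPolynomial (Fin n) ℝ) :
    (∀ f : MvPolynomial (Fin n) ℝ, (∀ i, f.degreeOf i ≤ κ i) → IsRealStable f →
        IsRealStable (T f) ∨ T f = 0) ↔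
      ((∃ (a b : MvPolynomial (Fin n) ℝ →ₗ[ℝ] ℝ) (P Q : MvPolynomial (Fin n) ℝ),
          IsRealStable P ∧ IsRealStable Q ∧ ProperPosition P Q ∧
            ∀ f : MvPolynomial (Fin n) ℝ, (∀ i, f.degreeOf i ≤ κ i) →
              T f = a f • P + b f • Q) ∨
        IsRealStable (algSymbolSigned 1 κ T) ∨
        IsRealStable (algSymbolSigned (-1) κ T)) := by
  constructor
  · intro hT
    by_cases h0 : ∀ c : ℂ, c ≠ 0 → ∀ W : Fin n → ℂ, (∀ i, 0 < (W i).im) →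
        T (∑ β ∈ Finset.Iic κ, (c * addPowCoeff κ W β).re • monomial β 1) ≠ 0
    · exact Or.inr (isRealStable_algSymbolSigned_of_forall_apply_re_ne_zero hT h0)
    · left
      push Not at h0
      obtain ⟨c, hc, W, hW, h0⟩ := h0
      set π : MvPolynomial (Fin n) ℝ →ₗ[ℝ] MvPolynomial (Fin n) ℝ :=
        ∑ β ∈ Finset.Iic κ, (lcoeff ℝ β).smulRight (monomial β 1) with hπ
      have hπf : ∀ f, π f = ∑ β ∈ Finset.Iic κ, coeff β f • monomial β 1 := by
        intro f
        simp [hπ]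
      obtain ⟨a, b, P, Q, hP, hQ, hPQ, h⟩ :=
        eq_smul_add_smul_of_forall_isRealStable (T := T ∘ₗ π) fun f => by
          rw [LinearMap.comp_apply, hπf]
          exact isRealStable_apply_of_apply_re_eq_zero hT hc hW h0 (degreeOf_sum_Iic_le _)
      refine ⟨a, b, P, Q, hP, hQ, hPQ, fun f hf => ?_⟩
      rw [← h, LinearMap.comp_apply, hπf, ← eq_sum_Iic_of_degreeOf_le hf]
  · rintro (⟨a, b, P, Q, -, -, hPQ, hT⟩ | hT | hT) f hdeg hf
    · rw [hT f hdeg]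
      exact isRealStable_smul_add_smul hPQ _ _
    · exact isRealStable_apply_of_symbol hT hdeg hf
    · exact isRealStable_apply_of_symbol_neg hT hdeg hf
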